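/- Let 0 < η ≤ 1, 0 < β ≤ 1, 0 < δ < 1/2, let ε > 0 be sufficiently small with η + β ≥ 4(1+δ)/3 + ε, and set k = ⌊2/((η+β)/2 − 2/3 − 2δ/3)⌋. Then for any constants c₂ ≥ c₁ > 0 there exist a constant C > 0 and N₀ such that for all N ≥ N₀ and all 𝔄, 𝔅 ⊆ {N+1, …, 2N} with c₁N^η ≤ |𝔄| ≤ c₂N^η and c₁N^β ≤ |𝔅| ≤ c₂N^β, there exist a ∈ 𝔄, b ∈ 𝔅 and a positive integer P with Ω(P) ≤ k such that |ab − P²| ≤ C · P^{1−δ}. -/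

import Mathlib

section

open MeasureTheory

/-- The additive character `x ↦ exp (2πix)` on the reals. -/
noncomputable def expChar (x : ℝ) : ℂ := Complex.exp ((2 * Real.pi * x : ℝ) * Complex.I)

theorem norm_expChar (x : ℝ) : ‖expChar x‖ = 1 := Complex.norm_exp_ofReal_mul_I _

theorem expChar_add (x y : ℝ) : expChar (x + y) = expChar x * expChar y := by
  rw [expChar, expChar, expChar, ← Complex.exp_add]; congr 1; push_cast; ring

theorem expChar_neg (x : ℝ) : expChar (-x) = (starRingEnd ℂ) (expChar x) := by
  rw [expChar, expChar, ← Complex.exp_conj]; congr 1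
  rw [map_mul, Complex.conj_I, Complex.conj_ofReal]; push_cast; ring

theorem continuous_expChar : Continuous expChar := by
  unfold expChar; fun_prop

theorem expChar_re (x : ℝ) : (expChar x).re = Real.cos (2 * Real.pi * x) :=
  Complex.exp_ofReal_mul_I_re _

/-- Cauchy–Schwarz for the integral of a continuous function over an interval. -/
theorem norm_integral_sq_le {f : ℝ → ℂ} (hf : Continuous f) {a b : ℝ} (hab : a < b) :
    ‖∫ t in a..b, f t‖ ^ 2 ≤ (b - a) * ∫ t in a..b, ‖f t‖ ^ 2 := by
  have h1 : ‖∫ t in a..b, f t‖ ≤ ∫ t in a..b, ‖f t‖ :=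
    intervalIntegral.norm_integral_le_integral_norm hab.le
  set m := (∫ t in a..b, ‖f t‖) / (b - a) with hm
  have hba : 0 < b - a := sub_pos.2 hab
  have h2 : 0 ≤ ∫ t in a..b, (‖f t‖ - m) ^ 2 :=
    intervalIntegral.integral_nonneg hab.le fun t _ => sq_nonneg _
  have h3 : ∫ t in a..b, (‖f t‖ - m) ^ 2
      = (∫ t in a..b, ‖f t‖ ^ 2) - 2 * m * (∫ t in a..b, ‖f t‖) + (b - a) * m ^ 2 := by
    have : ∀ t, (‖f t‖ - m) ^ 2 = ‖f t‖ ^ 2 - 2 * m * ‖f t‖ + m ^ 2 := fun t => by ring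
    simp_rw [this]
    rw [intervalIntegral.integral_add, intervalIntegral.integral_sub,
      intervalIntegral.integral_const_mul, intervalIntegral.integral_const, smul_eq_mul]
    all_goals exact Continuous.intervalIntegrable (by fun_prop) _ _
  have h4 : ∫ t in a..b, ‖f t‖ = m * (b - a) := by rw [hm]; field_simp
  rw [h3, h4] at h2
  have h5 : ‖∫ t in a..b, f t‖ ^ 2 ≤ (m * (b - a)) ^ 2 := by
    rw [h4] at h1; gcongr
  nlinarith [mul_nonneg hba.le h2]

/-- The Fourier transform of a Gaussian, in terms of `expChar`. -/
theorem integral_gaussian_mul_expChar {L : ℝ} (hL : 0 < L) (x : ℝ) :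
    Integrable (fun u : ℝ => (Real.exp (-Real.pi * u ^ 2 / L ^ 2) : ℂ) * expChar (x * u)) ∧
    ∫ u : ℝ, (Real.exp (-Real.pi * u ^ 2 / L ^ 2) : ℂ) * expChar (x * u)
      = L * Real.exp (-Real.pi * L ^ 2 * x ^ 2) := by
  have hb : 0 < ((1 / L ^ 2 : ℝ) : ℂ).re := by rw [Complex.ofReal_re]; positivity
  have hbp : 0 < ((Real.pi / L ^ 2 : ℝ) : ℂ).re := by
    rw [Complex.ofReal_re]; have := Real.pi_pos; positivity
  have e1 : ∀ u : ℝ, (Real.exp (-Real.pi * u ^ 2 / L ^ 2) : ℂ) * expChar (x * u)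
      = Complex.exp (Complex.I * ((2 * Real.pi * x : ℝ) : ℂ) * u)
        * Complex.exp (-((Real.pi / L ^ 2 : ℝ) : ℂ) * u ^ 2) := by
    intro u
    rw [expChar, Complex.ofReal_exp, ← Complex.exp_add, ← Complex.exp_add]
    congr 1; push_cast; field_simp; ring
  simp_rw [e1]
  constructor
  · have h0 : Integrable (fun u : ℝ => Real.exp (-(Real.pi / L ^ 2) * u ^ 2)) :=
      integrable_exp_neg_mul_sq (by rwa [Complex.ofReal_re] at hbp)
    refine h0.mono' (Continuous.aestronglyMeasurable (by fun_prop)) (Filter.Eventually.of_forall ?_)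
    intro u
    rw [norm_mul, mul_comm Complex.I, mul_right_comm, ← Complex.ofReal_mul,
      Complex.norm_exp_ofReal_mul_I, one_mul, ← Complex.ofReal_neg, ← Complex.ofReal_pow,
      ← Complex.ofReal_mul, ← Complex.ofReal_exp, Complex.norm_real, Real.norm_eq_abs,
      abs_of_pos (Real.exp_pos _)]
  · rw [fourierIntegral_gaussian hbp]
    have hpi := Real.pi_pos
    have e2 : (Real.pi : ℂ) / ((Real.pi / L ^ 2 : ℝ) : ℂ) = ((L ^ 2 : ℝ) : ℂ) := by
      rw [← Complex.ofReal_div]; congr 1; field_simp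
    have e3 : ((L ^ 2 : ℝ) : ℂ) ^ (1 / 2 : ℂ) = L := by
      have : (1 / 2 : ℂ) = ((1 / 2 : ℝ) : ℂ) := by push_cast; ring
      rw [this, ← Complex.ofReal_cpow (by positivity), ← Real.sqrt_eq_rpow, Real.sqrt_sq hL.le]
    rw [e2, e3, Complex.ofReal_exp]
    congr 2
    push_cast
    have : (Real.pi : ℂ) ≠ 0 := by exact_mod_cast hpi.ne'
    have : (L : ℂ) ≠ 0 := by exact_mod_cast hL.ne'
    field_simp
    ring

/-- The mean square of a finite exponential polynomial against a Gaussian weight. -/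
theorem integral_gaussian_mul_norm_sq_le {ι : Type*} (J : Finset ι) (c : ι → ℂ) (x : ι → ℝ) {L : ℝ}
    (hL : 0 < L) :
    Integrable (fun u : ℝ => Real.exp (-Real.pi * u ^ 2 / L ^ 2) *
      ‖∑ j ∈ J, c j * expChar (x j * u)‖ ^ 2) ∧
    ∫ u : ℝ, Real.exp (-Real.pi * u ^ 2 / L ^ 2) * ‖∑ j ∈ J, c j * expChar (x j * u)‖ ^ 2
      ≤ L * ∑ j ∈ J, ∑ k ∈ J, ‖c j‖ * ‖c k‖ * Real.exp (-Real.pi * L ^ 2 * (x j - x k) ^ 2) := by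
  have e1 : ∀ u : ℝ, ((Real.exp (-Real.pi * u ^ 2 / L ^ 2) *
      ‖∑ j ∈ J, c j * expChar (x j * u)‖ ^ 2 : ℝ) : ℂ) = ∑ j ∈ J, ∑ k ∈ J,
        (c j * (starRingEnd ℂ) (c k)) *
          ((Real.exp (-Real.pi * u ^ 2 / L ^ 2) : ℂ) * expChar ((x j - x k) * u)) := by
    intro u
    rw [Complex.ofReal_mul, Complex.ofReal_pow, ← Complex.mul_conj', map_sum, Finset.sum_mul_sum,
      Finset.mul_sum]
    refine Finset.sum_congr rfl fun j _ => ?_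
    rw [Finset.mul_sum]
    refine Finset.sum_congr rfl fun k _ => ?_
    rw [map_mul, ← expChar_neg, sub_mul, sub_eq_add_neg, expChar_add]
    ring
  have hint : ∀ j ∈ J, ∀ k ∈ J, Integrable (fun u : ℝ => (c j * (starRingEnd ℂ) (c k)) *
          ((Real.exp (-Real.pi * u ^ 2 / L ^ 2) : ℂ) * expChar ((x j - x k) * u))) :=
    fun j _ k _ => ((integral_gaussian_mul_expChar hL (x j - x k)).1).const_mul _
  have hI : Integrable (fun u : ℝ => ((Real.exp (-Real.pi * u ^ 2 / L ^ 2) *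
      ‖∑ j ∈ J, c j * expChar (x j * u)‖ ^ 2 : ℝ) : ℂ)) := by
    simp_rw [e1]
    exact integrable_finsetSum _ fun j hj => integrable_finsetSum _ fun k hk => hint j hj k hk
  refine ⟨by simpa only [RCLike.re_to_complex, Complex.ofReal_re] using hI.re, ?_⟩
  have e2 : ((∫ u : ℝ, Real.exp (-Real.pi * u ^ 2 / L ^ 2) *
      ‖∑ j ∈ J, c j * expChar (x j * u)‖ ^ 2 : ℝ) : ℂ) = ∑ j ∈ J, ∑ k ∈ J,
        (c j * (starRingEnd ℂ) (c k)) * (L * Real.exp (-Real.pi * L ^ 2 * (x j - x k) ^ 2)) := by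
    rw [← integral_complex_ofReal]
    simp_rw [e1]
    rw [integral_finsetSum _ fun j hj => integrable_finsetSum _ fun k hk => hint j hj k hk]
    refine Finset.sum_congr rfl fun j hj => ?_
    rw [integral_finsetSum _ fun k hk => hint j hj k hk]
    refine Finset.sum_congr rfl fun k hk => ?_
    rw [integral_const_mul, (integral_gaussian_mul_expChar hL (x j - x k)).2]
  refine (le_abs_self _).trans ?_
  rw [← Real.norm_eq_abs, ← Complex.norm_real, e2, Finset.mul_sum]
  refine (norm_sum_le _ _).trans (Finset.sum_le_sum fun j _ => ?_)
  rw [Finset.mul_sum]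
  refine (norm_sum_le _ _).trans (Finset.sum_le_sum fun k _ => ?_)
  rw [norm_mul, norm_mul, norm_mul, Complex.norm_conj, Complex.norm_real, Complex.norm_real,
    Real.norm_eq_abs, Real.norm_eq_abs, abs_of_pos hL, abs_of_pos (Real.exp_pos _)]
  apply le_of_eq; ring

/-- A double large sieve inequality of Bombieri–Iwaniec type. -/
theorem double_large_sieve {ι β : Type*} (J : Finset ι) (S : Finset β) (c : ι → ℂ) (x : ι → ℝ)
    (y : β → ℝ) {X L : ℝ} (hX : 0 < X) (hL : 0 < L) (hx : ∀ j ∈ J, |x j| ≤ X)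
    (hy : ∀ b ∈ S, |y b| + 1 / (6 * X) ≤ L)
    (hsep : ∀ b ∈ S, ∀ b' ∈ S, b ≠ b' → 1 / (3 * X) ≤ |y b - y b'|) :
    ∑ b ∈ S, ‖∑ j ∈ J, c j * expChar (x j * y b)‖ ^ 2
      ≤ 12 * Real.exp Real.pi * X * L *
        ∑ j ∈ J, ∑ k ∈ J, ‖c j‖ * ‖c k‖ * Real.exp (-Real.pi * L ^ 2 * (x j - x k) ^ 2) := by
  set l : ℝ := 1 / (6 * X) with hl
  have hl0 : 0 < l := by positivity
  have hpi := Real.pi_pos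
  set s : ℝ → ℂ := fun z => ∫ t in (-l)..l, expChar (z * t) with hs
  have hslow : ∀ z, |z| ≤ X → l ≤ ‖s z‖ := by
    intro z hz
    have h1 : (s z).re = ∫ t in (-l)..l, (expChar (z * t)).re := by
      have h2 := (Complex.reCLM.intervalIntegral_comp_comm (a := -l) (b := l) (μ := volume)
        (f := fun t => expChar (z * t))
        (Continuous.intervalIntegrable (continuous_expChar.comp (by fun_prop)) _ _))
      simpa using h2.symm
    have h2 : ∫ t in (-l)..l, (1 / 2 : ℝ) ≤ ∫ t in (-l)..l, (expChar (z * t)).re := by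
      apply intervalIntegral.integral_mono_on (by linarith)
      · exact Continuous.intervalIntegrable (by fun_prop) _ _
      · exact Continuous.intervalIntegrable
          (Complex.continuous_re.comp (continuous_expChar.comp (by fun_prop))) _ _
      · intro t ht
        rw [expChar_re, ← Real.cos_pi_div_three, ← Real.cos_abs (2 * Real.pi * _)]
        apply Real.cos_le_cos_of_nonneg_of_le_pi (abs_nonneg _) (by linarith)
        rw [abs_mul, abs_of_pos (by positivity : 0 < 2 * Real.pi), abs_mul]
        have : |z| * |t| ≤ X * l := by
          apply mul_le_mul hz (abs_le.2 ht) (abs_nonneg _) hX.le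
        have h3 : X * l = 1 / 6 := by rw [hl]; field_simp
        rw [h3] at this
        nlinarith
    rw [intervalIntegral.integral_const, smul_eq_mul] at h2
    calc l ≤ (s z).re := by rw [h1]; linarith
      _ ≤ ‖s z‖ := Complex.re_le_norm _
  have hs0 : ∀ j ∈ J, s (x j) ≠ 0 := fun j hj h => by
    have := hslow _ (hx j hj); rw [h, norm_zero] at this; linarith
  set c' : ι → ℂ := fun j => c j / s (x j) with hc'
  have hc'n : ∀ j ∈ J, ‖c' j‖ ≤ ‖c j‖ / l := fun j hj => by
    rw [hc']; simp only [norm_div]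
    exact div_le_div_of_nonneg_left (norm_nonneg _) hl0 (hslow _ (hx j hj))
  set T : ℝ → ℂ := fun u => ∑ j ∈ J, c' j * expChar (x j * u) with hT
  have hTc : Continuous T := by
    refine continuous_finsetSum _ fun j _ => ?_
    exact continuous_const.mul (continuous_expChar.comp (by fun_prop))
  have hrep : ∀ b, ∑ j ∈ J, c j * expChar (x j * y b) = ∫ u in (y b - l)..(y b + l), T u := by
    intro b
    have : ∫ u in (y b - l)..(y b + l), T u = ∫ t in (-l)..l, T (y b + t) := by
      rw [intervalIntegral.integral_comp_add_left]; congr 1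
    rw [this]
    simp only [hT]
    rw [intervalIntegral.integral_finsetSum]
    · refine Finset.sum_congr rfl fun j hj => ?_
      rw [intervalIntegral.integral_const_mul]
      simp_rw [mul_add, expChar_add]
      rw [intervalIntegral.integral_const_mul]
      change _ = c' j * (_ * s (x j))
      rw [hc']
      field_simp [hs0 j hj]
    · intro j _
      exact Continuous.intervalIntegrable
        (continuous_const.mul (continuous_expChar.comp (by fun_prop))) _ _
  obtain ⟨hG1, hG2⟩ := integral_gaussian_mul_norm_sq_le J c' x hL
  have hint : ∀ b, IntegrableOn (fun u => ‖T u‖ ^ 2) (Set.Ioc (y b - l) (y b + l)) := fun b =>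
    (Continuous.integrableOn_Icc (by fun_prop)).mono_set Set.Ioc_subset_Icc_self
  have hdisj : Set.PairwiseDisjoint (S : Set β) (fun b => Set.Ioc (y b - l) (y b + l)) := by
    intro b hb b' hb' hne
    rw [Function.onFun, Set.disjoint_left]
    intro u hu hu'
    have := hsep b hb b' hb' hne
    have h3 : 1 / (3 * X) = 2 * l := by rw [hl]; field_simp; norm_num
    rw [h3] at this
    have : |y b - y b'| < 2 * l := by
      rw [abs_lt]; constructor <;> linarith [hu.1, hu.2, hu'.1, hu'.2]
    linarith
  have key : ∑ b ∈ S, ∫ u in (y b - l)..(y b + l), ‖T u‖ ^ 2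
      ≤ Real.exp Real.pi * ∫ u : ℝ, Real.exp (-Real.pi * u ^ 2 / L ^ 2) * ‖T u‖ ^ 2 := by
    have h1 : ∑ b ∈ S, ∫ u in (y b - l)..(y b + l), ‖T u‖ ^ 2
        = ∫ u in ⋃ b ∈ S, Set.Ioc (y b - l) (y b + l), ‖T u‖ ^ 2 := by
      rw [integral_biUnion_finset S (fun b _ => measurableSet_Ioc) hdisj fun b _ => hint b]
      refine Finset.sum_congr rfl fun b _ => ?_
      rw [intervalIntegral.integral_of_le (by linarith)]
    rw [h1, ← integral_const_mul]
    have h2 : ∫ u in ⋃ b ∈ S, Set.Ioc (y b - l) (y b + l), ‖T u‖ ^ 2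
        ≤ ∫ u in ⋃ b ∈ S, Set.Ioc (y b - l) (y b + l),
          Real.exp Real.pi * (Real.exp (-Real.pi * u ^ 2 / L ^ 2) * ‖T u‖ ^ 2) := by
      apply setIntegral_mono_on
      · rw [integrableOn_finset_iUnion]; exact fun b _ => hint b
      · exact (hG1.const_mul _).integrableOn
      · exact Finset.measurableSet_biUnion _ fun b _ => measurableSet_Ioc
      · intro u hu
        simp only [Set.mem_iUnion] at hu
        obtain ⟨b, hb, hu⟩ := hu
        have huL : |u| ≤ L := by
          refine le_trans ?_ (hy b hb)
          have : |u - y b| ≤ l := abs_le.2 ⟨by linarith [hu.1], by linarith [hu.2]⟩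
          calc |u| = |y b + (u - y b)| := by congr 1; ring
            _ ≤ _ := (abs_add_le _ _).trans (by linarith)
        rw [← mul_assoc, ← Real.exp_add]
        refine le_mul_of_one_le_left (sq_nonneg _) (Real.one_le_exp ?_)
        have : u ^ 2 ≤ L ^ 2 := sq_le_sq' (by linarith [(abs_le.1 huL).1]) (abs_le.1 huL).2
        have : u ^ 2 / L ^ 2 ≤ 1 := div_le_one_of_le₀ this (by positivity)
        have : -Real.pi * u ^ 2 / L ^ 2 = -(Real.pi * (u ^ 2 / L ^ 2)) := by ring
        rw [this]; nlinarith
    refine h2.trans (setIntegral_le_integral (hG1.const_mul _) (Filter.Eventually.of_forall ?_))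
    intro u; simp only [Pi.zero_apply]; positivity
  calc ∑ b ∈ S, ‖∑ j ∈ J, c j * expChar (x j * y b)‖ ^ 2
      ≤ ∑ b ∈ S, (2 * l) * ∫ u in (y b - l)..(y b + l), ‖T u‖ ^ 2 := by
        refine Finset.sum_le_sum fun b _ => ?_
        rw [hrep]
        refine (norm_integral_sq_le hTc (by linarith)).trans (le_of_eq ?_)
        congr 1; ring
    _ = (2 * l) * ∑ b ∈ S, ∫ u in (y b - l)..(y b + l), ‖T u‖ ^ 2 := by rw [Finset.mul_sum]
    _ ≤ (2 * l) * (Real.exp Real.pi * (L * ∑ j ∈ J, ∑ k ∈ J,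
          ‖c' j‖ * ‖c' k‖ * Real.exp (-Real.pi * L ^ 2 * (x j - x k) ^ 2))) := by
        gcongr; exact key.trans (by gcongr)
    _ ≤ (2 * l) * (Real.exp Real.pi * (L * ∑ j ∈ J, ∑ k ∈ J,
          (‖c j‖ / l) * (‖c k‖ / l) * Real.exp (-Real.pi * L ^ 2 * (x j - x k) ^ 2))) := by
        gcongr with j hj k hk
        · exact hc'n j hj
        · exact hc'n k hk
    _ = _ := by
        have : ∀ j k, (‖c j‖ / l) * (‖c k‖ / l) * Real.exp (-Real.pi * L ^ 2 * (x j - x k) ^ 2)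
            = (1 / l ^ 2) * (‖c j‖ * ‖c k‖ * Real.exp (-Real.pi * L ^ 2 * (x j - x k) ^ 2)) := by
          intro j k; field_simp
        simp_rw [this, ← Finset.mul_sum]
        rw [hl]; field_simp; ring

end

open Finset in
theorem card_sq_mul_close_fiber_le (N D h H : ℕ) (hh : 0 < h) (hH : 0 < H) :
    #{x ∈ Icc (N + 1) (2 * N) ×ˢ Icc (N + 1) (2 * N) |
      |(h : ℤ) ^ 2 * (x.1 : ℤ) - (H : ℤ) ^ 2 * (x.2 : ℤ)| ≤ (D : ℤ)} ≤
      (2 * (D / h.gcd H ^ 2) + 1) * (N / (H / h.gcd H) ^ 2 + 1) := by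
  obtain ⟨g, u, v, hg, huv, rfl, rfl⟩ := Nat.exists_coprime' (m := h) (n := H)
    (Nat.gcd_pos_of_pos_left _ hh)
  have hu : 0 < u := Nat.pos_of_mul_pos_right hh
  have hv : 0 < v := Nat.pos_of_mul_pos_right hH
  have hgcd : (u * g).gcd (v * g) = g := by rw [Nat.gcd_mul_right, huv.gcd_eq_one, one_mul]
  rw [hgcd, Nat.mul_div_cancel _ hg]
  set E : ℕ := D / g ^ 2 with hE
  have hcard : #(Icc (-(E : ℤ)) E ×ˢ range (N / v ^ 2 + 1)) = (2 * E + 1) * (N / v ^ 2 + 1) := by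
    rw [card_product, Int.card_Icc, card_range]
    congr 1
    omega
  rw [← hcard]
  have hv2 : 0 < v ^ 2 := by positivity
  refine card_le_card_of_injOn
    (fun x => ((u : ℤ) ^ 2 * x.1 - (v : ℤ) ^ 2 * x.2, (x.1 - (N + 1)) / v ^ 2)) ?_ ?_
  · intro x hx
    simp only [coe_filter, Set.mem_ofPred_eq, mem_product, mem_Icc] at hx
    obtain ⟨⟨⟨h1, h2⟩, h3, h4⟩, h5⟩ := hx
    simp only [coe_product, Set.mem_prod, mem_coe, mem_Icc, mem_range]
    refine ⟨?_, ?_⟩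
    · rw [← abs_le]
      have h6 : |((u : ℤ) ^ 2 * x.1 - (v : ℤ) ^ 2 * x.2)| * (g : ℤ) ^ 2 ≤ D := by
        rw [← abs_of_nonneg (sq_nonneg (g : ℤ)), ← abs_mul]
        refine le_trans (le_of_eq ?_) h5
        push_cast
        ring_nf
      rw [hE]
      push_cast
      exact (Int.le_ediv_iff_mul_le (by positivity)).2 h6
    · exact Nat.lt_succ_of_le (Nat.div_le_div_right (by omega))
  · rintro ⟨a, b⟩ hx ⟨a', b'⟩ hy hxy
    simp only [coe_filter, Set.mem_ofPred_eq, mem_product, mem_Icc] at hx hy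
    simp only [Prod.mk.injEq] at hxy
    obtain ⟨e1, e2⟩ := hxy
    have hdvd : ((v ^ 2 : ℕ) : ℤ) ∣ (a : ℤ) - a' := by
      have hc : IsCoprime ((v ^ 2 : ℕ) : ℤ) ((u ^ 2 : ℕ) : ℤ) :=
        (Nat.isCoprime_iff_coprime).2 (Nat.Coprime.pow 2 2 huv.symm)
      refine hc.dvd_of_dvd_mul_left ⟨(b : ℤ) - b', ?_⟩
      push_cast
      linear_combination e1
    have ha : a = a' := by
      obtain ⟨c, hc⟩ := hdvd
      have q1 := Nat.div_add_mod (a - (N + 1)) (v ^ 2)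
      have q2 := Nat.div_add_mod (a' - (N + 1)) (v ^ 2)
      have l1 := Nat.mod_lt (a - (N + 1)) hv2
      have l2 := Nat.mod_lt (a' - (N + 1)) hv2
      rw [e2] at q1
      generalize v ^ 2 * ((a' - (N + 1)) / v ^ 2) = w at q1 q2
      generalize (a - (N + 1)) % v ^ 2 = r₁ at q1 l1
      generalize (a' - (N + 1)) % v ^ 2 = r₂ at q2 l2
      have : (v ^ 2 : ℕ) * c < (v ^ 2 : ℕ) * 1 := by rw [← hc]; omega
      have c1 : c < 1 := lt_of_mul_lt_mul_left this (by positivity)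
      have : (v ^ 2 : ℕ) * (-1) < (v ^ 2 : ℕ) * c := by rw [← hc]; omega
      have c2 : -1 < c := lt_of_mul_lt_mul_left this (by positivity)
      have : c = 0 := by omega
      rw [this] at hc
      omega
    subst ha
    have : (v : ℤ) ^ 2 * b = (v : ℤ) ^ 2 * b' := by linarith
    have := mul_left_cancel₀ (by positivity) this
    simp only [Prod.mk.injEq, true_and]
    exact_mod_cast this

open Finset in
theorem sum_gcd_sq_le (H : ℕ) (hH : 0 < H) :
    ∑ h ∈ Icc 1 H, ((h.gcd H : ℕ) : ℝ) ^ 2 ≤ (H : ℝ) ^ 2 * (1 + Real.log H) := by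
  have h1 : ∑ h ∈ Icc 1 H, ((h.gcd H : ℕ) : ℝ) ^ 2 ≤ ∑ h ∈ Icc 1 H, ∑ e ∈ H.divisors,
      if e ∣ h then (e : ℝ) ^ 2 else 0 := by
    refine sum_le_sum fun h hh => ?_
    have := single_le_sum (s := H.divisors) (f := fun e : ℕ => if e ∣ h then (e : ℝ) ^ 2 else 0)
      (fun _ _ => by positivity) (Nat.mem_divisors.2 ⟨Nat.gcd_dvd_right h H, hH.ne'⟩)
    simpa [Nat.gcd_dvd_left] using this
  refine h1.trans ?_
  rw [sum_comm]
  have h2 : ∀ e ∈ H.divisors, (∑ h ∈ Icc 1 H, if e ∣ h then (e : ℝ) ^ 2 else 0) = (e : ℝ) * H := by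
    intro e he
    have hd := Nat.dvd_of_mem_divisors he
    have he0 := Nat.pos_of_mem_divisors he
    rw [← sum_filter, sum_const, nsmul_eq_mul]
    have : Icc 1 H = Ioc 0 H := rfl
    rw [this, Nat.Ioc_filter_dvd_card_eq_div, Nat.cast_div hd (by positivity)]
    field_simp
  rw [sum_congr rfl h2, ← Nat.sum_div_divisors]
  have h3 : ∀ e ∈ H.divisors, ((H / e : ℕ) : ℝ) * H = (H : ℝ) ^ 2 * ((e : ℝ)⁻¹) := by
    intro e he
    have hd := Nat.dvd_of_mem_divisors he
    have he0 := Nat.pos_of_mem_divisors he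
    rw [Nat.cast_div hd (by positivity)]
    field_simp
  rw [sum_congr rfl h3, ← mul_sum]
  gcongr
  have h4 : ∑ e ∈ H.divisors, (e : ℝ)⁻¹ ≤ ∑ e ∈ Icc 1 H, (e : ℝ)⁻¹ := by
    refine sum_le_sum_of_subset_of_nonneg ?_ (fun _ _ _ => by positivity)
    intro e he
    exact mem_Icc.2 ⟨Nat.pos_of_mem_divisors he, Nat.divisor_le he⟩
  have h5 := harmonic_le_one_add_log H
  rw [harmonic_eq_sum_Icc] at h5
  push_cast at h5
  linarith

open Finset in
theorem sum_max_le (G : ℕ) (c : ℕ → ℕ → ℝ) (f : ℕ → ℕ → ℝ)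
    (hf : ∀ h ∈ Icc 1 G, ∀ k ∈ Icc 1 G, 0 ≤ f h k)
    (h1 : ∀ h ∈ Icc 1 G, ∀ k ∈ Icc 1 G, c h k ≤ f h k)
    (h2 : ∀ h ∈ Icc 1 G, ∀ k ∈ Icc 1 G, c h k ≤ f k h) :
    ∑ h ∈ Icc 1 G, ∑ k ∈ Icc 1 G, c h k ≤ 2 * ∑ k ∈ Icc 1 G, ∑ h ∈ Icc 1 k, f h k := by
  have e : ∀ k ∈ Icc 1 G, ∑ h ∈ Icc 1 k, f h k = ∑ h ∈ Icc 1 G, if h ≤ k then f h k else 0 := by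
    intro k hk
    rw [← sum_filter]
    refine sum_congr ?_ fun _ _ => rfl
    ext h
    simp only [mem_Icc, mem_filter] at hk ⊢
    omega
  have h3 : ∑ h ∈ Icc 1 G, ∑ k ∈ Icc 1 G, c h k ≤ ∑ h ∈ Icc 1 G, ∑ k ∈ Icc 1 G,
      ((if h ≤ k then f h k else 0) + if k ≤ h then f k h else 0) := by
    refine sum_le_sum fun h hh => sum_le_sum fun k hk => ?_
    have a1 := hf h hh k hk
    have a2 := hf k hk h hh
    have a3 := h1 h hh k hk
    have a4 := h2 h hh k hk
    split_ifs <;> linarith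
  refine h3.trans (le_of_eq ?_)
  simp only [sum_add_distrib]
  rw [sum_comm, sum_congr rfl e, two_mul]

open Finset in
theorem card_sq_mul_close_le (N G D : ℕ) (hG : 0 < G) :
    (#{q ∈ (Icc 1 G ×ˢ Icc (N + 1) (2 * N)) ×ˢ (Icc 1 G ×ˢ Icc (N + 1) (2 * N)) |
      |(q.1.1 : ℤ) ^ 2 * (q.1.2 : ℤ) - (q.2.1 : ℤ) ^ 2 * (q.2.2 : ℤ)| ≤ (D : ℤ)} : ℝ) ≤
      4 * (1 + Real.log G) * (D * N + D * G ^ 2 + N * G + G ^ 2) := by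
  set I := Icc (N + 1) (2 * N) with hI
  set c : ℕ → ℕ → ℕ := fun h k => #{x ∈ I ×ˢ I |
      |(h : ℤ) ^ 2 * (x.1 : ℤ) - (k : ℤ) ^ 2 * (x.2 : ℤ)| ≤ (D : ℤ)} with hc
  have hcs : ∀ h k, c h k = c k h := by
    intro h k
    refine card_bij' (fun x _ => (x.2, x.1)) (fun x _ => (x.2, x.1)) ?_ ?_ ?_ ?_
    · intro x hx
      simp only [mem_filter, mem_product] at hx ⊢
      rw [abs_sub_comm]
      tauto
    · intro x hx
      simp only [mem_filter, mem_product] at hx ⊢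
      rw [abs_sub_comm]
      tauto
    · simp
    · simp
  have e1 : (#{q ∈ (Icc 1 G ×ˢ I) ×ˢ (Icc 1 G ×ˢ I) |
      |(q.1.1 : ℤ) ^ 2 * (q.1.2 : ℤ) - (q.2.1 : ℤ) ^ 2 * (q.2.2 : ℤ)| ≤ (D : ℤ)} : ℝ) =
      ∑ h ∈ Icc 1 G, ∑ k ∈ Icc 1 G, (c h k : ℝ) := by
    simp only [hc, card_filter, sum_product, Nat.cast_sum]
    refine sum_congr rfl fun h _ => ?_
    rw [sum_comm]
  rw [e1]
  set f : ℕ → ℕ → ℝ := fun h k => 2 * D * N * (k : ℝ)⁻¹ ^ 2 + 2 * D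
    + N * (k : ℝ)⁻¹ ^ 2 * ((h.gcd k : ℕ) : ℝ) ^ 2 + 1 with hf
  have hcf : ∀ h ∈ Icc 1 G, ∀ k ∈ Icc 1 G, (c h k : ℝ) ≤ f h k := by
    intro h hh k hk
    rw [mem_Icc] at hh hk
    have hg : 0 < h.gcd k := Nat.gcd_pos_of_pos_left _ (by omega)
    have hk0 : (0 : ℝ) < k := by exact_mod_cast (show 0 < k by omega)
    have hg0 : (1 : ℝ) ≤ (h.gcd k : ℕ) := by exact_mod_cast hg
    have := card_sq_mul_close_fiber_le N D h k (by omega) (by omega)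
    have h1 : (c h k : ℝ) ≤ ((2 * (D / h.gcd k ^ 2) + 1) * (N / (k / h.gcd k) ^ 2 + 1) : ℕ) := by
      exact Nat.cast_le.2 this
    refine h1.trans ?_
    push_cast
    have h2 : ((D / h.gcd k ^ 2 : ℕ) : ℝ) ≤ D / ((h.gcd k : ℕ) : ℝ) ^ 2 := by
      refine Nat.cast_div_le.trans ?_
      push_cast
      rfl
    have h3 : ((N / (k / h.gcd k) ^ 2 : ℕ) : ℝ) ≤
        N * ((k : ℝ)⁻¹) ^ 2 * ((h.gcd k : ℕ) : ℝ) ^ 2 := by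
      refine Nat.cast_div_le.trans ?_
      push_cast
      rw [Nat.cast_div (Nat.gcd_dvd_right h k) (by positivity)]
      apply le_of_eq
      field_simp
    set g : ℝ := ((h.gcd k : ℕ) : ℝ)
    calc _ ≤ (2 * (D / g ^ 2) + 1) * (N * ((k : ℝ)⁻¹) ^ 2 * g ^ 2 + 1) := by gcongr
      _ = 2 * D * N * (k : ℝ)⁻¹ ^ 2 + 2 * (D / g ^ 2) + N * (k : ℝ)⁻¹ ^ 2 * g ^ 2 + 1 := by
        field_simp
        ring
      _ ≤ _ := by
        rw [hf]
        have : (D : ℝ) / g ^ 2 ≤ D := div_le_self (by positivity) (one_le_pow₀ hg0)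
        simp only
        linarith
  have hmain := sum_max_le G (fun h k => (c h k : ℝ)) f
    (fun h _ k _ => by simp only [hf]; positivity) hcf
    (fun h hh k hk => by rw [hcs h k]; exact hcf k hk h hh)
  refine hmain.trans ?_
  have hlog : 0 ≤ Real.log G := Real.log_natCast_nonneg G
  have hinner : ∀ k ∈ Icc 1 G, ∑ h ∈ Icc 1 k, f h k ≤
      2 * D * N * (k : ℝ)⁻¹ + 2 * D * G + N * (1 + Real.log G) + G := by
    intro k hk
    rw [mem_Icc] at hk
    have hk0 : (0 : ℝ) < k := by exact_mod_cast (show 0 < k by omega)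
    have hkG : (k : ℝ) ≤ G := by exact_mod_cast hk.2
    simp only [hf, sum_add_distrib, ← mul_sum, sum_const, Nat.card_Icc, nsmul_eq_mul]
    have := sum_gcd_sq_le k (by omega)
    have hl : Real.log k ≤ Real.log G := Real.log_le_log hk0 hkG
    have h3 : N * ((k : ℝ)⁻¹) ^ 2 * ∑ h ∈ Icc 1 k, ((h.gcd k : ℕ) : ℝ) ^ 2 ≤
        N * (1 + Real.log G) := by
      calc _ ≤ N * ((k : ℝ)⁻¹) ^ 2 * ((k : ℝ) ^ 2 * (1 + Real.log G)) := by
            gcongr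
            refine this.trans ?_
            gcongr
        _ = _ := by field_simp
    have h4 : ((k + 1 - 1 : ℕ) : ℝ) * (2 * D * N * (k : ℝ)⁻¹ ^ 2) = 2 * D * N * (k : ℝ)⁻¹ := by
      rw [Nat.add_sub_cancel]
      field_simp
    have h5 : ((k + 1 - 1 : ℕ) : ℝ) * (2 * D) ≤ 2 * D * G := by
      rw [Nat.add_sub_cancel]
      nlinarith [Nat.cast_nonneg (α := ℝ) D]
    have h6 : ((k + 1 - 1 : ℕ) : ℝ) * 1 ≤ G := by
      rw [Nat.add_sub_cancel, mul_one]; exact hkG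
    linarith [h4, h5, h6, h3]
  have hsum : ∑ k ∈ Icc 1 G, (k : ℝ)⁻¹ ≤ 1 + Real.log G := by
    have h5 := harmonic_le_one_add_log G
    rw [harmonic_eq_sum_Icc] at h5
    push_cast at h5
    exact h5
  calc _ ≤ 2 * ∑ k ∈ Icc 1 G, (2 * D * N * (k : ℝ)⁻¹ + 2 * D * G + N * (1 + Real.log G) + G) := by
        gcongr with k hk
        exact hinner k hk
    _ = 2 * (2 * D * N * ∑ k ∈ Icc 1 G, (k : ℝ)⁻¹ + G *
        (2 * D * G + N * (1 + Real.log G) + G)) := by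
        simp only [sum_add_distrib, ← mul_sum, sum_const, Nat.card_Icc, nsmul_eq_mul,
          Nat.add_sub_cancel]
        ring
    _ ≤ 2 * (2 * D * N * (1 + Real.log G) + G * (2 * D * G + N * (1 + Real.log G) + G)) := by
        gcongr
    _ ≤ _ := by
        have q1 : 0 ≤ Real.log G * (D * G ^ 2) := by positivity
        have q2 : 0 ≤ Real.log G * (N * G) := by positivity
        have q3 : 0 ≤ Real.log G * (G ^ 2 : ℝ) := by positivity
        have q4 : (0 : ℝ) ≤ N * G := by positivity
        have q5 : (0 : ℝ) ≤ G ^ 2 := by positivity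
        have q6 : (0 : ℝ) ≤ D * G ^ 2 := by positivity
        nlinarith

open Finset in
theorem exists_card_divisors_le_rpow (ε : ℝ) (hε : 0 < ε) :
    ∃ C : ℝ, 1 ≤ C ∧ ∀ n : ℕ, 0 < n → (#n.divisors : ℝ) ≤ C * (n : ℝ) ^ ε := by
  obtain ⟨p₀, hp₀⟩ := exists_nat_ge ((2 : ℝ) ^ (1 / ε))
  set M : ℝ := 1 + 1 / (ε * Real.log 2) with hM
  have hl2 : 0 < Real.log 2 := Real.log_pos (by norm_num)
  have hM1 : 1 ≤ M := by
    have : 0 < 1 / (ε * Real.log 2) := by positivity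
    linarith
  refine ⟨M ^ p₀, one_le_pow₀ hM1, fun n hn => ?_⟩
  rw [Nat.card_divisors hn.ne']
  have hfac : (n : ℝ) ^ ε = ∏ p ∈ n.primeFactors, (((p : ℝ) ^ ε) ^ (n.factorization p)) := by
    conv_lhs => rw [← Nat.prod_factorization_pow_eq_self hn.ne']
    rw [Finsupp.prod, Nat.cast_prod, ← Real.finsetProd_rpow _ _ (fun _ _ => by positivity)]
    refine prod_congr rfl fun p _ => ?_
    push_cast
    rw [← Real.rpow_natCast, ← Real.rpow_mul (by positivity), mul_comm, Real.rpow_mul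
      (by positivity),
      Real.rpow_natCast]
  have hterm : ∀ p ∈ n.primeFactors, ((n.factorization p + 1 : ℕ) : ℝ) ≤
      (if p < p₀ then M else 1) * (((p : ℝ) ^ ε) ^ (n.factorization p)) := by
    intro p hp
    have hp2 : (2 : ℝ) ≤ p := by exact_mod_cast (Nat.prime_of_mem_primeFactors hp).two_le
    set a := n.factorization p
    push_cast
    split_ifs with h
    · have h1 : 1 + ε * Real.log 2 ≤ (p : ℝ) ^ ε := by
        calc 1 + ε * Real.log 2 ≤ Real.exp (ε * Real.log 2) := by
              linarith [Real.add_one_le_exp (ε * Real.log 2)]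
          _ = (2 : ℝ) ^ ε := by rw [Real.rpow_def_of_pos (by norm_num), mul_comm]
          _ ≤ _ := Real.rpow_le_rpow (by norm_num) hp2 hε.le
      have h2 : 1 + a * (ε * Real.log 2) ≤ ((p : ℝ) ^ ε) ^ a := by
        refine (one_add_mul_le_pow (by nlinarith [mul_pos hε hl2]) a).trans ?_
        gcongr
      calc (a : ℝ) + 1 ≤ M * (1 + a * (ε * Real.log 2)) := by
            rw [hM]
            have : (1 + 1 / (ε * Real.log 2)) * (1 + a * (ε * Real.log 2)) =
              a + 1 + (a * (ε * Real.log 2) + 1 / (ε * Real.log 2)) := by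
              field_simp
              ring
            rw [this]
            have : 0 ≤ (a * (ε * Real.log 2) + 1 / (ε * Real.log 2)) := by positivity
            linarith
        _ ≤ _ := by gcongr
    · have h1 : (2 : ℝ) ≤ (p : ℝ) ^ ε := by
        have : (2 : ℝ) ^ (1 / ε) ≤ p := hp₀.trans (by exact_mod_cast not_lt.1 h)
        calc (2 : ℝ) = ((2 : ℝ) ^ (1 / ε)) ^ ε := by
              rw [← Real.rpow_mul (by norm_num), one_div, inv_mul_cancel₀ hε.ne', Real.rpow_one]
          _ ≤ _ := Real.rpow_le_rpow (by positivity) this hε.le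
      rw [one_mul]
      calc (a : ℝ) + 1 ≤ 2 ^ a := by exact_mod_cast Nat.lt_two_pow_self
        _ ≤ _ := by gcongr
  rw [hfac, Nat.cast_prod]
  refine (prod_le_prod (fun _ _ => by positivity) hterm).trans ?_
  rw [prod_mul_distrib]
  gcongr
  rw [← prod_filter, prod_const]
  refine pow_le_pow_right₀ hM1 ?_
  calc _ ≤ #(range p₀) := card_le_card fun p hp => by
        simp only [mem_filter] at hp
        exact mem_range.2 hp.2
    _ = p₀ := card_range _

open Finset in
theorem log_factorial_eq_sum (n : ℕ) :
    Real.log (n.factorial) = ∑ p ∈ n.primesLE, (n.factorial.factorization p : ℝ) * Real.log p := by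
  conv_lhs => rw [← Nat.prod_factorization_pow_eq_self n.factorial_ne_zero]
  rw [Finsupp.prod_of_support_subset (s := n.primesLE) _ _ _ (by simp), Nat.cast_prod,
    Real.log_prod]
  · refine sum_congr rfl fun p _ => ?_
    push_cast
    rw [Real.log_pow]
  · intro p hp
    have := (Nat.prime_of_mem_primesLE hp).pos
    positivity
  · intro p hp
    rw [Nat.support_factorization, Nat.mem_primeFactors] at hp
    exact Nat.mem_primesLE.2 ⟨(hp.1.dvd_factorial).1 hp.2.1, hp.1⟩

open Finset in
theorem log_le_sum_log_div_sub_one (n : ℕ) (hn : 0 < n) :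
    Real.log n - 1 ≤ ∑ p ∈ n.primesLE, Real.log p / ((p : ℝ) - 1) := by
  have hn0 : (0 : ℝ) < n := by exact_mod_cast hn
  have h1 : n * Real.log n - n ≤ Real.log n.factorial := by
    have h := Real.pow_div_factorial_le_exp (x := (n : ℝ)) hn0.le n
    have hf : (0 : ℝ) < n.factorial := by exact_mod_cast n.factorial_pos
    have h2 := Real.log_le_log (by positivity) h
    rw [Real.log_exp, Real.log_div (by positivity) (by positivity), Real.log_pow] at h2
    linarith
  have h2 : Real.log n.factorial ≤ n * ∑ p ∈ n.primesLE, Real.log p / ((p : ℝ) - 1) := by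
    rw [log_factorial_eq_sum, mul_sum]
    refine sum_le_sum fun p hp => ?_
    have hp' := Nat.prime_of_mem_primesLE hp
    have : Fact p.Prime := ⟨hp'⟩
    have hp1 : (1 : ℝ) < p := by exact_mod_cast hp'.one_lt
    have h3 := (sub_one_mul_padicValNat_factorial_lt_of_ne_zero p hn.ne').le
    rw [← Nat.factorization_def _ hp'] at h3
    have h4 : ((p : ℝ) - 1) * n.factorial.factorization p ≤ n := by
      have := (Nat.cast_le (α := ℝ)).2 h3
      rwa [Nat.cast_mul, Nat.cast_sub hp'.one_le, Nat.cast_one] at this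
    have h5 : (n.factorial.factorization p : ℝ) ≤ n / ((p : ℝ) - 1) := by
      rw [le_div_iff₀ (by linarith)]
      linarith
    calc _ ≤ n / ((p : ℝ) - 1) * Real.log p := by
          have := Real.log_nonneg hp1.le
          gcongr
      _ = _ := by ring
  have h3 : n * (Real.log n - 1) ≤ n * ∑ p ∈ n.primesLE, Real.log p / ((p : ℝ) - 1) := by linarith
  exact le_of_mul_le_mul_left h3 hn0

open Finset in
theorem sum_log_div_le (n : ℕ) (hn : 0 < n) :
    ∑ p ∈ n.primesLE, Real.log p / p ≤ Real.log n + Real.log 4 := by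
  have hn0 : (0 : ℝ) < n := by exact_mod_cast hn
  have h1 : Real.log n.factorial ≤ n * Real.log n := by
    rw [← Real.log_pow]
    exact Real.log_le_log (by exact_mod_cast n.factorial_pos) (by exact_mod_cast n.factorial_le_pow)
  have h2 : n * ∑ p ∈ n.primesLE, Real.log p / p - Chebyshev.theta n ≤ Real.log n.factorial := by
    rw [log_factorial_eq_sum, Chebyshev.theta_eq_sum_primesLE_log, mul_sum, ← sum_sub_distrib]
    refine sum_le_sum fun p hp => ?_
    have hp' := Nat.prime_of_mem_primesLE hp
    have hp1 : (1 : ℝ) < p := by exact_mod_cast hp'.one_lt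
    have h3 : n / p ≤ n.factorial.factorization p := by
      rw [Nat.factorization_factorial hp' (b := Nat.log p n + 2) (by omega)]
      have := single_le_sum (s := Ico 1 (Nat.log p n + 2)) (f := fun i => n / p ^ i)
        (fun _ _ => Nat.zero_le _) (mem_Ico.2 ⟨le_refl 1, by omega⟩)
      simpa using this
    have h4 : (n : ℝ) / p - 1 ≤ n.factorial.factorization p := by
      have h5 : ((n / p : ℕ) : ℝ) ≤ n.factorial.factorization p := by exact_mod_cast h3
      have h6 := Nat.lt_floor_add_one ((n : ℝ) / p)
      rw [Nat.floor_div_natCast, Nat.floor_natCast] at h6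
      linarith
    calc _ = ((n : ℝ) / p - 1) * Real.log p := by ring
      _ ≤ _ := by
          have := Real.log_nonneg hp1.le
          gcongr
  have h3 := Chebyshev.theta_le_log4_mul_x hn0.le
  have h4 : n * ∑ p ∈ n.primesLE, Real.log p / p ≤ n * (Real.log n + Real.log 4) := by linarith
  exact le_of_mul_le_mul_left h4 hn0

open Finset in
theorem exists_sum_log_div_sub_one_le :
    ∃ C : ℝ, 0 ≤ C ∧ ∀ n : ℕ, 0 < n →
      ∑ p ∈ n.primesLE, Real.log p / ((p : ℝ) - 1) ≤ Real.log n + C := by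
  have hs : Summable fun n : ℕ => 1 / (n : ℝ) ^ (3 / 2 : ℝ) :=
    Real.summable_one_div_nat_rpow.2 (by norm_num)
  have hl4 : 0 ≤ Real.log 4 := Real.log_nonneg (by norm_num)
  refine ⟨Real.log 4 + 4 * ∑' n : ℕ, 1 / (n : ℝ) ^ (3 / 2 : ℝ), by positivity, fun n hn => ?_⟩
  have h1 : ∑ p ∈ n.primesLE, Real.log p / ((p : ℝ) - 1) ≤
      ∑ p ∈ n.primesLE, (Real.log p / p + 4 * (1 / (p : ℝ) ^ (3 / 2 : ℝ))) := by
    refine sum_le_sum fun p hp => ?_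
    have hp' := Nat.prime_of_mem_primesLE hp
    have hp2 : (2 : ℝ) ≤ p := by exact_mod_cast hp'.two_le
    have hlog : Real.log p ≤ 2 * √p := by
      have := Real.log_le_sub_one_of_pos (Real.sqrt_pos.2 (show (0 : ℝ) < p by linarith))
      rw [Real.log_sqrt (by linarith)] at this
      linarith
    have hlog0 : 0 ≤ Real.log p := Real.log_nonneg (by linarith)
    have h2 : Real.log p / ((p : ℝ) - 1) = Real.log p / p + Real.log p / (p * (p - 1)) := by
      have : (p : ℝ) - 1 ≠ 0 := by linarith
      field_simp
      ring
    rw [h2]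
    gcongr
    have h3 : (p : ℝ) ^ (3 / 2 : ℝ) = p * √p := by
      rw [Real.sqrt_eq_rpow, ← Real.rpow_one_add' (by linarith) (by norm_num)]
      norm_num
    rw [h3, mul_one_div, div_le_div_iff₀ (by nlinarith) (by positivity)]
    have hsq : √(p : ℝ) * √p = p := Real.mul_self_sqrt (by linarith)
    calc Real.log p * (p * √p) ≤ 2 * √p * (p * √p) := by gcongr
      _ = 2 * p * (√p * √p) := by ring
      _ = 2 * p * p := by rw [hsq]
      _ ≤ _ := by nlinarith
  refine h1.trans ?_
  rw [sum_add_distrib, ← mul_sum]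
  have := sum_log_div_le n hn
  have h2 := hs.sum_le_tsum n.primesLE (fun _ _ => by positivity)
  linarith

open Finset ArithmeticFunction in
/-- The diagonal variables of the quadratic form attached to the sieve of level `R`. -/
noncomputable def sieveDiag (R m : ℕ) : ℝ :=
  if m ∈ Icc 1 R then (moebius m : ℝ) * √((m.totient : ℝ) / m) / m.totient else 0

open Finset ArithmeticFunction in
/-- The sieve weights of level `R`. -/
noncomputable def sieveWeight (R e : ℕ) : ℝ :=
  e * ∑ n ∈ Icc 1 R with e ∣ n, (moebius (n / e) : ℝ) * sieveDiag R n

open Finset ArithmeticFunction in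
theorem squarefree_of_sieveDiag_ne_zero {R m : ℕ} (h : sieveDiag R m ≠ 0) : Squarefree m := by
  unfold sieveDiag at h
  split_ifs at h with h1
  · by_contra h2
    rw [moebius_eq_zero_of_not_squarefree h2] at h
    simp at h
  · exact absurd rfl h

open Finset ArithmeticFunction in
theorem squarefree_of_sieveWeight_ne_zero {R e : ℕ} (h : sieveWeight R e ≠ 0) : Squarefree e := by
  unfold sieveWeight at h
  obtain ⟨n, hn, hne⟩ := exists_ne_zero_of_sum_ne_zero (right_ne_zero_of_mul h)
  exact (squarefree_of_sieveDiag_ne_zero (right_ne_zero_of_mul hne)).squarefree_of_dvd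
    (mem_filter.1 hn).2

open Finset ArithmeticFunction in
theorem sum_moebius_div_of_dvd (R m n : ℕ) (hm : 0 < m) (hn : n ∈ Icc 1 R) :
    (∑ e ∈ Icc 1 R with m ∣ e ∧ e ∣ n, (moebius (n / e) : ℝ)) = if n = m then 1 else 0 := by
  rw [mem_Icc] at hn
  by_cases hd : m ∣ n
  · obtain ⟨k, rfl⟩ := hd
    have hk : 0 < k := Nat.pos_of_mul_pos_left (show 0 < m * k by omega)
    have h1 : (∑ e ∈ Icc 1 R with m ∣ e ∧ e ∣ m * k, (moebius (m * k / e) : ℝ)) =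
        ∑ d ∈ k.divisors, (moebius (k / d) : ℝ) := by
      symm
      refine sum_bij (fun d _ => m * d) ?_ ?_ ?_ ?_
      · intro d hd
        have hdk := Nat.dvd_of_mem_divisors hd
        have hd0 := Nat.pos_of_mem_divisors hd
        have hle : m * d ≤ m * k := Nat.mul_le_mul_left m (Nat.le_of_dvd hk hdk)
        have : 0 < m * d := by positivity
        simp only [mem_filter, mem_Icc]
        exact ⟨⟨this, by omega⟩, dvd_mul_right m d, mul_dvd_mul_left m hdk⟩
      · intro a _ b _ hab
        exact Nat.eq_of_mul_eq_mul_left hm hab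
      · intro e he
        simp only [mem_filter, mem_Icc] at he
        obtain ⟨_, ⟨d, rfl⟩, h3⟩ := he
        exact ⟨d, Nat.mem_divisors.2 ⟨Nat.dvd_of_mul_dvd_mul_left hm h3, hk.ne'⟩, rfl⟩
      · intro d _
        rw [Nat.mul_div_mul_left _ _ hm]
    rw [h1, Nat.sum_div_divisors k (fun d => (moebius d : ℝ)), ← Int.cast_sum]
    rw [← coe_mul_zeta_apply, moebius_mul_coe_zeta, one_apply]
    have : m * k = m ↔ k = 1 := by
      constructor
      · intro h; exact Nat.eq_of_mul_eq_mul_left hm (by omega)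
      · rintro rfl; simp
    simp [this]
  · rw [if_neg (by rintro rfl; exact hd dvd_rfl)]
    refine sum_eq_zero fun e he => ?_
    simp only [mem_filter] at he
    exact absurd (he.2.1.trans he.2.2) hd

open Finset ArithmeticFunction in
theorem sum_sieveWeight_div (R m : ℕ) (hm : 0 < m) :
    ∑ e ∈ Icc 1 R with m ∣ e, sieveWeight R e / e = sieveDiag R m := by
  have h1 : ∀ e ∈ (Icc 1 R).filter (m ∣ ·), sieveWeight R e / e =
      ∑ n ∈ Icc 1 R, if e ∣ n then (moebius (n / e) : ℝ) * sieveDiag R n else 0 := by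
    intro e he
    have : (0 : ℝ) < e := by
      simp only [mem_filter, mem_Icc] at he
      exact_mod_cast (show 0 < e by omega)
    unfold sieveWeight
    rw [sum_filter]
    field_simp
  rw [sum_congr rfl h1, sum_comm]
  have h2 : ∀ n ∈ Icc 1 R, (∑ e ∈ Icc 1 R with m ∣ e,
      if e ∣ n then (moebius (n / e) : ℝ) * sieveDiag R n else 0) =
      if n = m then sieveDiag R n else 0 := by
    intro n hn
    rw [← sum_filter, filter_filter, ← sum_mul, sum_moebius_div_of_dvd R m n hm hn]
    split_ifs <;> simp
  rw [sum_congr rfl h2, sum_ite_eq']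
  split_ifs with h
  · rfl
  · rw [sieveDiag, if_neg h]

open Finset in
theorem sum_sum_mul_gcd (R : ℕ) (S : Finset ℕ) (f : ℕ → ℕ) (w : ℕ → ℝ)
    (hf : ∀ e ∈ S, f e ∈ Icc 1 R) :
    ∑ a ∈ S, ∑ b ∈ S, w a * w b * ((f a).gcd (f b) : ℕ) =
      ∑ m ∈ Icc 1 R, (m.totient : ℝ) * (∑ e ∈ S with m ∣ f e, w e) ^ 2 := by
  have h1 : ∀ a ∈ S, ∀ b ∈ S, (((f a).gcd (f b) : ℕ) : ℝ) =
      ∑ m ∈ Icc 1 R, (m.totient : ℝ) * (if m ∣ f a then 1 else 0) * (if m ∣ f b then 1 else 0) := by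
    intro a ha b hb
    have ha' := mem_Icc.1 (hf a ha)
    have h2 : 0 < (f a).gcd (f b) := Nat.gcd_pos_of_pos_left _ (by omega)
    conv_lhs => rw [← Nat.sum_totient ((f a).gcd (f b))]
    have h3 : ((f a).gcd (f b)).divisors = {m ∈ Icc 1 R | m ∣ f a ∧ m ∣ f b} := by
      ext m
      simp only [Nat.mem_divisors, mem_filter, mem_Icc, Nat.dvd_gcd_iff]
      constructor
      · rintro ⟨⟨h4, h5⟩, _⟩
        have := Nat.le_of_dvd (by omega) h4
        have := Nat.pos_of_dvd_of_pos h4 (by omega)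
        exact ⟨⟨by omega, by omega⟩, h4, h5⟩
      · rintro ⟨_, h4⟩
        exact ⟨h4, h2.ne'⟩
    rw [h3, Nat.cast_sum, sum_filter]
    refine sum_congr rfl fun m _ => ?_
    by_cases h4 : m ∣ f a <;> by_cases h5 : m ∣ f b <;> simp [h4, h5]
  calc _ = ∑ a ∈ S, ∑ b ∈ S, ∑ m ∈ Icc 1 R, (m.totient : ℝ) *
        ((if m ∣ f a then w a else 0) * (if m ∣ f b then w b else 0)) := by
        refine sum_congr rfl fun a ha => sum_congr rfl fun b hb => ?_
        rw [h1 a ha b hb, mul_sum]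
        refine sum_congr rfl fun m _ => ?_
        split_ifs <;> ring
    _ = ∑ m ∈ Icc 1 R, ∑ a ∈ S, ∑ b ∈ S, (m.totient : ℝ) *
        ((if m ∣ f a then w a else 0) * (if m ∣ f b then w b else 0)) := by
        rw [sum_comm (s := Icc 1 R)]
        refine sum_congr rfl fun a _ => ?_
        rw [sum_comm]
    _ = _ := by
        refine sum_congr rfl fun m _ => ?_
        rw [sq, sum_filter, sum_mul_sum, mul_sum]
        refine sum_congr rfl fun a _ => ?_
        rw [mul_sum]

theorem lcm_prime_pow {p e j : ℕ} (hp : p.Prime) (he : Squarefree e) (hj : 0 < j) :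
    e.lcm (p ^ j) = p ^ j * (e / e.gcd p) := by
  by_cases h : p ∣ e
  · obtain ⟨k, rfl⟩ := h
    obtain ⟨i, rfl⟩ : ∃ i, j = i + 1 := ⟨j - 1, by omega⟩
    have hc : p.Coprime k := (Nat.squarefree_mul_iff.1 he).1
    rw [Nat.gcd_eq_right (dvd_mul_right p k), Nat.mul_div_cancel_left _ hp.pos, pow_succ',
      Nat.lcm_mul_left, (Nat.Coprime.pow_right i hc.symm).lcm_eq_mul]
    ring
  · have hc : e.Coprime p := ((Nat.Prime.coprime_iff_not_dvd hp).2 h).symm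
    rw [hc.gcd_eq_one, Nat.div_one, (Nat.Coprime.pow_right j hc).lcm_eq_mul, mul_comm]

theorem lcm_lcm_prime_pow {p a b j : ℕ} (hp : p.Prime) (ha : Squarefree a) (hb : Squarefree b)
    (hj : 0 < j) :
    (a.lcm b).lcm (p ^ j) = p ^ j * (a / a.gcd p).lcm (b / b.gcd p) := by
  rw [← Nat.lcm_mul_left, ← lcm_prime_pow hp ha hj, ← lcm_prime_pow hp hb hj]
  apply Nat.dvd_antisymm
  · exact Nat.lcm_dvd (Nat.lcm_dvd ((Nat.dvd_lcm_left _ _).trans (Nat.dvd_lcm_left _ _))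
      ((Nat.dvd_lcm_left _ _).trans (Nat.dvd_lcm_right _ _)))
      ((Nat.dvd_lcm_right _ _).trans (Nat.dvd_lcm_left _ _))
  · exact Nat.lcm_dvd (Nat.lcm_dvd ((Nat.dvd_lcm_left _ _).trans (Nat.dvd_lcm_left _ _))
      (Nat.dvd_lcm_right _ _)) (Nat.lcm_dvd ((Nat.dvd_lcm_right _ _).trans (Nat.dvd_lcm_left _ _))
      (Nat.dvd_lcm_right _ _))

theorem inv_lcm_eq {a b : ℕ} (ha : 0 < a) (hb : 0 < b) :
    ((a.lcm b : ℕ) : ℝ)⁻¹ = (a : ℝ)⁻¹ * (b : ℝ)⁻¹ * (a.gcd b : ℕ) := by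
  have h := Nat.gcd_mul_lcm a b
  have h' : ((a.gcd b : ℕ) : ℝ) * (a.lcm b : ℕ) = a * b := by exact_mod_cast h
  have h1 : (0 : ℝ) < (a.lcm b : ℕ) := by exact_mod_cast Nat.lcm_pos ha hb
  have : (0 : ℝ) < a := by exact_mod_cast ha
  have : (0 : ℝ) < b := by exact_mod_cast hb
  field_simp
  linarith

open Finset in
/-- The quadratic form of the sieve of level `R`, twisted by the divisor `q`. -/
noncomputable def sieveForm (R q : ℕ) : ℝ :=
  ∑ a ∈ Icc 1 R, ∑ b ∈ Icc 1 R, sieveWeight R a * sieveWeight R b * (((a.lcm b).lcm q : ℕ) : ℝ)⁻¹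

open Finset in
/-- The sum of the reciprocals of the squarefree numbers up to `R`. -/
noncomputable def sqfreeSum (R : ℕ) : ℝ := ∑ m ∈ Icc 1 R with Squarefree m, (m : ℝ)⁻¹

open Finset ArithmeticFunction in
theorem totient_mul_sieveDiag_sq {R m : ℕ} (hm : m ∈ Icc 1 R) :
    (m.totient : ℝ) * sieveDiag R m ^ 2 = if Squarefree m then (m : ℝ)⁻¹ else 0 := by
  have hm0 : 0 < m := (mem_Icc.1 hm).1
  have h1 : (0 : ℝ) < m := by exact_mod_cast hm0
  have h2 : (0 : ℝ) < m.totient := by exact_mod_cast Nat.totient_pos.2 hm0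
  split_ifs with h
  · rw [sieveDiag, if_pos hm, div_pow, mul_pow, Real.sq_sqrt (by positivity), ← Int.cast_pow,
      moebius_sq_eq_one_of_squarefree h]
    field_simp
    simp
  · have : sieveDiag R m = 0 := by
      by_contra h'
      exact h (squarefree_of_sieveDiag_ne_zero h')
    simp [this]

open Finset in
theorem sieveForm_one (R : ℕ) : sieveForm R 1 = sqfreeSum R := by
  have h1 : sieveForm R 1 = ∑ a ∈ Icc 1 R, ∑ b ∈ Icc 1 R,
      (sieveWeight R a / a) * (sieveWeight R b / b) * ((id a).gcd (id b) : ℕ) := by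
    refine sum_congr rfl fun a ha => sum_congr rfl fun b hb => ?_
    rw [Nat.lcm_one_right, inv_lcm_eq (mem_Icc.1 ha).1 (mem_Icc.1 hb).1]
    simp only [id]
    ring
  rw [h1, sum_sum_mul_gcd R _ id _ (fun e he => he), sqfreeSum, sum_filter]
  refine sum_congr rfl fun m hm => ?_
  rw [← totient_mul_sieveDiag_sq hm]
  simp only [id]
  rw [sum_sieveWeight_div R m (mem_Icc.1 hm).1]

open Finset in
theorem sieveForm_prime_pow {R p j : ℕ} (hp : p.Prime) (hj : 0 < j) :
    sieveForm R (p ^ j) = ((p : ℝ) ^ j)⁻¹ * ∑ m ∈ Icc 1 R with ¬ p ∣ m,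
      (m.totient : ℝ) * (sieveDiag R m + (p - 1) * sieveDiag R (p * m)) ^ 2 := by
  set f : ℕ → ℕ := fun e => e / e.gcd p with hf
  have hfpos : ∀ e ∈ Icc 1 R, f e ∈ Icc 1 R := by
    intro e he
    rw [mem_Icc] at he ⊢
    refine ⟨Nat.div_pos (Nat.gcd_le_left p he.1) (Nat.gcd_pos_of_pos_left _ he.1), ?_⟩
    exact (Nat.div_le_self _ _).trans he.2
  have h1 : sieveForm R (p ^ j) = ((p : ℝ) ^ j)⁻¹ * ∑ a ∈ Icc 1 R, ∑ b ∈ Icc 1 R,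
      (sieveWeight R a / f a) * (sieveWeight R b / f b) * ((f a).gcd (f b) : ℕ) := by
    rw [sieveForm, mul_sum]
    refine sum_congr rfl fun a ha => ?_
    rw [mul_sum]
    refine sum_congr rfl fun b hb => ?_
    by_cases hwa : sieveWeight R a = 0
    · simp [hwa]
    by_cases hwb : sieveWeight R b = 0
    · simp [hwb]
    rw [lcm_lcm_prime_pow hp (squarefree_of_sieveWeight_ne_zero hwa)
      (squarefree_of_sieveWeight_ne_zero hwb) hj, Nat.cast_mul, mul_inv,
      inv_lcm_eq (mem_Icc.1 (hfpos a ha)).1 (mem_Icc.1 (hfpos b hb)).1]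
    push_cast
    ring
  rw [h1, sum_sum_mul_gcd R _ f _ hfpos, sum_filter]
  congr 1
  refine sum_congr rfl fun m hm => ?_
  have hm0 := (mem_Icc.1 hm).1
  have hp0 : (0 : ℝ) < p := by exact_mod_cast hp.pos
  by_cases hpm : ¬ p ∣ m
  · rw [if_pos hpm]
    congr 2
    rw [← sum_sieveWeight_div R m hm0, ← sum_sieveWeight_div R (p * m) (Nat.mul_pos hp.pos hm0)]
    simp only [sum_filter]
    rw [mul_sum, ← sum_add_distrib]
    refine sum_congr rfl fun e he => ?_
    by_cases hw : sieveWeight R e = 0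
    · simp [hw]
    have hsq := squarefree_of_sieveWeight_ne_zero hw
    have hcop : p.Coprime m := (Nat.Prime.coprime_iff_not_dvd hp).2 hpm
    by_cases hpe : p ∣ e
    · obtain ⟨k, rfl⟩ := hpe
      have hk0 : (0 : ℝ) < k := by
        have := (mem_Icc.1 he).1
        exact_mod_cast Nat.pos_of_mul_pos_left (show 0 < p * k by omega)
      have hfe : f (p * k) = k := by
        rw [hf]
        simp only
        rw [Nat.gcd_eq_right (dvd_mul_right p k), Nat.mul_div_cancel_left _ hp.pos]
      have e1 : m ∣ p * k ↔ m ∣ k := hcop.symm.dvd_mul_left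
      have e2 : p * m ∣ p * k ↔ m ∣ k := Nat.mul_dvd_mul_iff_left hp.pos
      rw [hfe]
      simp only [e1, e2]
      split_ifs
      · push_cast
        field_simp
        ring
      · simp
    · have hfe : f e = e := by
        have hc : e.Coprime p := ((Nat.Prime.coprime_iff_not_dvd hp).2 hpe).symm
        rw [hf]
        simp only
        rw [hc.gcd_eq_one, Nat.div_one]
      have e2 : ¬ p * m ∣ e := fun h => hpe ((dvd_mul_right p m).trans h)
      rw [hfe, if_neg e2]
      simp
  · rw [if_neg hpm]
    rw [not_not] at hpm
    rw [sum_eq_zero]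
    · simp
    · intro e he
      simp only [mem_filter] at he
      by_contra hne
      have hw : sieveWeight R e ≠ 0 := by
        intro h
        simp [h] at hne
      have hsq := squarefree_of_sieveWeight_ne_zero hw
      have h2 : p ∣ f e := hpm.trans he.2
      have h3 : p ∣ e := h2.trans (Nat.div_dvd_of_dvd (Nat.gcd_dvd_left e p))
      obtain ⟨k, rfl⟩ := h3
      have hc : p.Coprime k := (Nat.squarefree_mul_iff.1 hsq).1
      have hfe : f (p * k) = k := by
        rw [hf]
        simp only
        rw [Nat.gcd_eq_right (dvd_mul_right p k), Nat.mul_div_cancel_left _ hp.pos]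
      rw [hfe] at h2
      exact (Nat.Prime.coprime_iff_not_dvd hp).1 hc h2

open Finset in
/-- The part of `sqfreeSum R` over `(R / p, R]`. -/
noncomputable def sqfreeTail (R p : ℕ) : ℝ :=
  ∑ m ∈ Icc 1 R with Squarefree m, if R < p * m then (m : ℝ)⁻¹ else 0

theorem one_sub_sqrt_sq_le {p : ℝ} (hp : 2 ≤ p) : (1 - √((p - 1) / p)) ^ 2 ≤ 4 / (9 * p ^ 2) := by
  set s := √((p - 1) / p) with hs
  have hp0 : 0 < p := by linarith
  have h0 : 0 ≤ (p - 1) / p := div_nonneg (by linarith) hp0.le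
  have hsq : s ^ 2 = (p - 1) / p := Real.sq_sqrt h0
  have hs0 : 0 ≤ s := Real.sqrt_nonneg _
  have h1 : s ^ 2 = 1 - 1 / p := by rw [hsq]; field_simp
  have hp2 : 1 / p ≤ 1 / 2 := one_div_le_one_div_of_le (by norm_num) hp
  have hpp : 0 < 1 / p := by positivity
  have hhalf : 1 / 2 ≤ s := by nlinarith
  have hs1 : s ≤ 1 := by nlinarith
  have h2 : 1 - s ≤ (2 / 3) * (1 / p) := by
    have : (1 - s) * (1 + s) = 1 / p := by ring_nf; rw [h1]; ring
    nlinarith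
  calc (1 - s) ^ 2 ≤ ((2 / 3) * (1 / p)) ^ 2 := by
        apply pow_le_pow_left₀ (by linarith) h2
    _ = _ := by field_simp; norm_num

open Finset ArithmeticFunction in
theorem sieveDiag_add_mul {R p m : ℕ} (hp : p.Prime) (hm : m ∈ Icc 1 R) (hpm : ¬ p ∣ m)
    (h : p * m ≤ R) :
    sieveDiag R m + (p - 1) * sieveDiag R (p * m) = sieveDiag R m * (1 - √(((p : ℝ) - 1) / p)) := by
  have hm0 : 0 < m := (mem_Icc.1 hm).1
  have h1 : (0 : ℝ) < m := by exact_mod_cast hm0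
  have h2 : (0 : ℝ) < m.totient := by exact_mod_cast Nat.totient_pos.2 hm0
  have hp1 : (0 : ℝ) < (p : ℝ) - 1 := by
    have : (1 : ℝ) < p := by exact_mod_cast hp.one_lt
    linarith
  have hp0 : (0 : ℝ) < p := by linarith
  have hcop : p.Coprime m := (Nat.Prime.coprime_iff_not_dvd hp).2 hpm
  have hmem : p * m ∈ Icc 1 R := mem_Icc.2 ⟨Nat.mul_pos hp.pos hm0, h⟩
  have e : (((p : ℝ) - 1) * m.totient / (p * m)) = (((p : ℝ) - 1) / p) * ((m.totient : ℝ) / m) := by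
    field_simp
  rw [sieveDiag, sieveDiag, if_pos hm, if_pos hmem,
    isMultiplicative_moebius.map_mul_of_coprime hcop,
    moebius_apply_prime hp, Nat.totient_mul hcop, Nat.totient_prime hp]
  push_cast
  rw [Nat.cast_sub hp.one_le, Nat.cast_one, e, Real.sqrt_mul (by positivity)]
  field_simp
  ring

open Finset in
theorem sieveForm_prime_pow_le {R p j : ℕ} (hp : p.Prime) (hj : 0 < j) :
    sieveForm R (p ^ j) ≤ ((p : ℝ) ^ j)⁻¹ * (4 / (9 * p ^ 2) * sqfreeSum R + sqfreeTail R p) := by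
  have hp2 : (2 : ℝ) ≤ p := by exact_mod_cast hp.two_le
  rw [sieveForm_prime_pow hp hj, sqfreeSum, sqfreeTail]
  refine mul_le_mul_of_nonneg_left ?_ (by positivity)
  rw [mul_sum, ← sum_add_distrib]
  simp only [sum_filter]
  refine sum_le_sum fun m hm => ?_
  have hm0 : (0 : ℝ) < m := by exact_mod_cast (mem_Icc.1 hm).1
  by_cases hsq : Squarefree m
  · rw [if_pos hsq]
    by_cases hpm : ¬ p ∣ m
    · rw [if_pos hpm]
      have hd := totient_mul_sieveDiag_sq hm
      rw [if_pos hsq] at hd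
      by_cases hR : R < p * m
      · rw [if_pos hR]
        have : sieveDiag R (p * m) = 0 := by
          rw [sieveDiag, if_neg]
          rw [mem_Icc]
          omega
        rw [this, mul_zero, add_zero, hd]
        have : 0 ≤ 4 / (9 * (p : ℝ) ^ 2) * (m : ℝ)⁻¹ := by positivity
        linarith
      · rw [if_neg hR, sieveDiag_add_mul hp hm hpm (not_lt.1 hR), mul_pow, ← mul_assoc, hd,
          add_zero,
          mul_comm]
        gcongr
        exact one_sub_sqrt_sq_le hp2
    · rw [if_neg hpm]
      split_ifs <;> positivity
  · rw [if_neg hsq]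
    have h1 : sieveDiag R m = 0 := by
      by_contra h'
      exact hsq (squarefree_of_sieveDiag_ne_zero h')
    have h2 : sieveDiag R (p * m) = 0 := by
      by_contra h'
      exact hsq ((squarefree_of_sieveDiag_ne_zero h').squarefree_of_dvd (dvd_mul_left m p))
    rw [h1, h2]
    simp

open Finset in
theorem sum_Icc_inv_le (R : ℕ) : ∑ m ∈ Icc 1 R, (m : ℝ)⁻¹ ≤ 1 + Real.log R := by
  have h5 := harmonic_le_one_add_log R
  rw [harmonic_eq_sum_Icc] at h5
  push_cast at h5
  exact h5

open Finset in
theorem log_le_sum_Icc_inv (R : ℕ) : Real.log (R + 1) ≤ ∑ m ∈ Icc 1 R, (m : ℝ)⁻¹ := by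
  have h5 := log_add_one_le_harmonic R
  rw [harmonic_eq_sum_Icc] at h5
  push_cast at h5
  exact h5

open Finset in
theorem sqfreeTail_le_sqfreeSum (R p : ℕ) : sqfreeTail R p ≤ sqfreeSum R := by
  refine sum_le_sum fun m _ => ?_
  split_ifs
  · exact le_rfl
  · positivity

open Finset in
theorem sqfreeTail_le_log {R p : ℕ} (hR : 0 < R) (hp : 0 < p) :
    sqfreeTail R p ≤ 1 + Real.log p := by
  have hR0 : (0 : ℝ) < R := by exact_mod_cast hR
  have hp0 : (0 : ℝ) < p := by exact_mod_cast hp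
  have h1 : sqfreeTail R p ≤ ∑ m ∈ Icc 1 R \ Icc 1 (R / p), (m : ℝ)⁻¹ := by
    rw [sqfreeTail, ← sum_filter, filter_filter]
    refine sum_le_sum_of_subset_of_nonneg ?_ (fun _ _ _ => by positivity)
    intro m hm
    simp only [mem_filter, mem_Icc, mem_sdiff, not_and, not_le] at hm ⊢
    refine ⟨hm.1, fun _ => ?_⟩
    rw [Nat.div_lt_iff_lt_mul hp, mul_comm]
    exact hm.2.2
  rw [sum_sdiff_eq_sub (Icc_subset_Icc_right (Nat.div_le_self R p))] at h1
  have h2 := sum_Icc_inv_le R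
  have h3 := log_le_sum_Icc_inv (R / p)
  have h4 : Real.log R - Real.log p ≤ Real.log ((R / p : ℕ) + 1) := by
    rw [← Real.log_div hR0.ne' hp0.ne']
    refine Real.log_le_log (by positivity) ?_
    have h6 := Nat.lt_floor_add_one ((R : ℝ) / p)
    rw [Nat.floor_div_natCast, Nat.floor_natCast] at h6
    exact h6.le
  linarith

open Finset in
theorem sum_inv_sq_le (R : ℕ) : ∑ m ∈ Icc 1 R, ((m : ℝ) ^ 2)⁻¹ ≤ 1.66 := by
  have h := hasSum_zeta_two
  have h1 := h.summable.sum_le_tsum (Icc 1 R) (fun _ _ => by positivity)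
  rw [h.tsum_eq] at h1
  simp only [one_div] at h1
  have h3 := Real.pi_lt_d2
  have h4 := Real.pi_pos
  nlinarith

open Finset in
theorem log_le_sqfreeSum (R : ℕ) (hR : 0 < R) : Real.log R ≤ 1.66 * sqfreeSum R := by
  have h0 : Real.log R ≤ ∑ n ∈ Icc 1 R, (n : ℝ)⁻¹ := by
    refine le_trans (Real.log_le_log (by exact_mod_cast hR) ?_) (log_le_sum_Icc_inv R)
    linarith
  refine h0.trans ?_
  choose a b hab hsq using Nat.sq_mul_squarefree
  have h1 : ∑ n ∈ Icc 1 R, (n : ℝ)⁻¹ ≤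
      ∑ x ∈ (Icc 1 R) ×ˢ {m ∈ Icc 1 R | Squarefree m}, ((x.1 : ℝ) ^ 2)⁻¹ * (x.2 : ℝ)⁻¹ := by
    have e : ∑ n ∈ Icc 1 R, (n : ℝ)⁻¹ =
        ∑ x ∈ (Icc 1 R).image (fun n => (b n, a n)), ((x.1 : ℝ) ^ 2)⁻¹ * (x.2 : ℝ)⁻¹ := by
      rw [sum_image]
      · refine sum_congr rfl fun n _ => ?_
        conv_lhs => rw [← hab n]
        push_cast
        rw [mul_inv]
      · intro n _ n' _ h
        simp only [Prod.mk.injEq] at h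
        rw [← hab n, ← hab n', h.1, h.2]
    rw [e]
    refine sum_le_sum_of_subset_of_nonneg ?_ (fun _ _ _ => by positivity)
    intro x hx
    rw [mem_image] at hx
    obtain ⟨n, hn, rfl⟩ := hx
    rw [mem_Icc] at hn
    have h2 := hab n
    have hb : 0 < b n := Nat.pos_of_ne_zero (by intro h; rw [h] at h2; simp at h2; omega)
    have ha : 0 < a n := Nat.pos_of_ne_zero (by intro h; rw [h] at h2; simp at h2; omega)
    simp only [mem_product, mem_Icc, mem_filter]
    refine ⟨⟨hb, ?_⟩, ⟨ha, ?_⟩, hsq n⟩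
    · nlinarith [Nat.le_mul_of_pos_right (b n ^ 2) ha]
    · nlinarith [Nat.le_mul_of_pos_left (a n) (pow_pos hb 2)]
  rw [sum_product] at h1
  simp only [← mul_sum] at h1
  rw [← sum_mul] at h1
  refine h1.trans ?_
  have h2 : 0 ≤ sqfreeSum R := sum_nonneg fun _ _ => by positivity
  exact mul_le_mul_of_nonneg_right (sum_inv_sq_le R) h2

open Finset ArithmeticFunction in
theorem abs_sieveDiag_le (R n : ℕ) (hn : 0 < n) : |sieveDiag R n| ≤ #n.divisors / (n : ℝ) := by
  have h1 : (0 : ℝ) < n := by exact_mod_cast hn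
  have h2 : (0 : ℝ) < n.totient := by exact_mod_cast Nat.totient_pos.2 hn
  have hτ : (1 : ℝ) ≤ #n.divisors := by
    exact_mod_cast Nat.one_le_iff_ne_zero.2 (by simpa using hn.ne')
  rw [sieveDiag]
  split_ifs with h
  · have h3 : (n : ℝ) ≤ #n.divisors * n.totient := by
      have : n ≤ #n.divisors * n.totient := by
        conv_lhs => rw [← Nat.sum_totient n]
        rw [← smul_eq_mul]
        refine sum_le_card_nsmul _ _ _ fun d hd => ?_
        exact Nat.le_of_dvd (Nat.totient_pos.2 hn)
          (Nat.totient_dvd_of_dvd (Nat.dvd_of_mem_divisors hd))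
      exact_mod_cast this
    have hmu : |(moebius n : ℝ)| ≤ 1 := by exact_mod_cast abs_moebius_le_one
    have h4 : √((n.totient : ℝ) / n) ≤ 1 := by
      rw [Real.sqrt_le_one, div_le_one h1]
      exact_mod_cast Nat.totient_le n
    rw [abs_div, abs_mul, abs_of_pos h2, abs_of_nonneg (Real.sqrt_nonneg _),
      div_le_div_iff₀ h2 h1]
    calc |(moebius n : ℝ)| * √((n.totient : ℝ) / n) * n ≤ 1 * 1 * n := by gcongr
      _ ≤ _ := by linarith
  · rw [abs_zero]
    positivity

open Finset ArithmeticFunction in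
theorem exists_abs_sieveWeight_le (ε : ℝ) (hε : 0 < ε) :
    ∃ C : ℝ, 0 < C ∧ ∀ R : ℕ, 0 < R → ∀ e ∈ Icc 1 R, |sieveWeight R e| ≤ C * (R : ℝ) ^ ε := by
  obtain ⟨C, hC1, hC⟩ := exists_card_divisors_le_rpow (ε / 2) (by positivity)
  refine ⟨C * (1 + 1 / (ε / 2)), by positivity, fun R hR e he => ?_⟩
  have hR1 : (1 : ℝ) ≤ R := by exact_mod_cast hR
  have he0 : (0 : ℝ) < e := by exact_mod_cast (mem_Icc.1 he).1
  have h1 : |sieveWeight R e| ≤ e * ∑ n ∈ Icc 1 R with e ∣ n, C * (R : ℝ) ^ (ε / 2) *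
      (n : ℝ)⁻¹ := by
    rw [sieveWeight, abs_mul, abs_of_pos he0]
    gcongr
    refine (abs_sum_le_sum_abs _ _).trans (sum_le_sum fun n hn => ?_)
    have hn' := mem_Icc.1 (mem_filter.1 hn).1
    have hn0 : (0 : ℝ) < n := by exact_mod_cast hn'.1
    have hmu : |(moebius (n / e) : ℝ)| ≤ 1 := by exact_mod_cast abs_moebius_le_one
    rw [abs_mul]
    calc _ ≤ 1 * (#n.divisors / (n : ℝ)) := by
          gcongr
          exact abs_sieveDiag_le R n hn'.1
      _ ≤ C * (n : ℝ) ^ (ε / 2) / n := by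
          rw [one_mul]
          gcongr
          exact hC n hn'.1
      _ ≤ C * (R : ℝ) ^ (ε / 2) / n := by
          have : (n : ℝ) ≤ R := by exact_mod_cast hn'.2
          gcongr
      _ = _ := by ring
  have h2 : e * ∑ n ∈ Icc 1 R with e ∣ n, (n : ℝ)⁻¹ ≤ ∑ m ∈ Icc 1 R, (m : ℝ)⁻¹ := by
    rw [mul_sum]
    calc _ = ∑ n ∈ Icc 1 R with e ∣ n, ((n / e : ℕ) : ℝ)⁻¹ := by
          refine sum_congr rfl fun n hn => ?_
          rw [Nat.cast_div (mem_filter.1 hn).2 he0.ne', inv_div]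
          rfl
      _ = ∑ m ∈ ({n ∈ Icc 1 R | e ∣ n}).image (· / e), (m : ℝ)⁻¹ := by
          rw [sum_image]
          intro n hn n' hn' h
          simp only [coe_filter, mem_Icc, Set.mem_ofPred_eq] at hn hn'
          simp only at h
          rw [← Nat.div_mul_cancel hn.2, h, Nat.div_mul_cancel hn'.2]
      _ ≤ _ := by
          refine sum_le_sum_of_subset_of_nonneg ?_ (fun _ _ _ => by positivity)
          intro m hm
          simp only [mem_image, mem_filter, mem_Icc] at hm ⊢
          obtain ⟨n, ⟨hn, hen⟩, rfl⟩ := hm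
          exact ⟨Nat.div_pos (Nat.le_of_dvd hn.1 hen) (mem_Icc.1 he).1,
            (Nat.div_le_self _ _).trans hn.2⟩
  have h3 : 1 + Real.log R ≤ (1 + 1 / (ε / 2)) * (R : ℝ) ^ (ε / 2) := by
    have h4 := Real.log_le_rpow_div (x := (R : ℝ)) (by positivity) (half_pos hε)
    have h5 : 1 ≤ (R : ℝ) ^ (ε / 2) := Real.one_le_rpow hR1 (by positivity)
    calc _ ≤ (R : ℝ) ^ (ε / 2) + (R : ℝ) ^ (ε / 2) / (ε / 2) := by linarith
      _ = _ := by ring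
  calc _ ≤ _ := h1
    _ = C * (R : ℝ) ^ (ε / 2) * (e * ∑ n ∈ Icc 1 R with e ∣ n, (n : ℝ)⁻¹) := by
        rw [← mul_sum]; ring
    _ ≤ C * (R : ℝ) ^ (ε / 2) * ((1 + 1 / (ε / 2)) * (R : ℝ) ^ (ε / 2)) := by
        refine mul_le_mul_of_nonneg_left ?_ (by positivity)
        exact h2.trans ((sum_Icc_inv_le R).trans h3)
    _ = C * (1 + 1 / (ε / 2)) * ((R : ℝ) ^ (ε / 2) * (R : ℝ) ^ (ε / 2)) := by ring
    _ = _ := by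
        rw [← Real.rpow_add (by linarith), add_halves]

open Finset in
theorem sum_inv_pow_le {p : ℝ} (hp : 1 < p) (J : ℕ) :
    ∑ j ∈ Icc 1 J, (p ^ j)⁻¹ ≤ 1 / (p - 1) := by
  have hp0 : 0 < p := by linarith
  have hp1 : 0 < p - 1 := by linarith
  have : ∑ j ∈ Icc 1 J, (p ^ j)⁻¹ = (1 - (p ^ J)⁻¹) / (p - 1) := by
    induction J with
    | zero => simp
    | succ n ih =>
      rw [sum_Icc_succ_top (by omega), ih]
      field_simp
      ring
  rw [this]
  have : 0 ≤ (p ^ J)⁻¹ := by positivity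
  gcongr
  linarith

open Finset in
theorem sum_primesLE_inv_sq_le (n : ℕ) :
    ∑ p ∈ n.primesLE, 1 / ((p : ℝ) - 1) * (4 / (9 * (p : ℝ) ^ 2)) ≤ 2 / 9 := by
  have h1 : ∀ m : ℕ, ∑ k ∈ Icc 2 (m + 1), 1 / ((k : ℝ) - 1) * (4 / (9 * (k : ℝ) ^ 2)) ≤
      2 / 9 * (1 - 1 / ((m : ℝ) + 1)) := by
    intro m
    induction m with
    | zero => simp
    | succ i ih =>
      rw [sum_Icc_succ_top (by omega)]
      have : (1 : ℝ) / (((i + 1 + 1 : ℕ) : ℝ) - 1) * (4 / (9 * ((i + 1 + 1 : ℕ) : ℝ) ^ 2)) ≤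
          2 / 9 * (1 / ((i : ℝ) + 1) - 1 / ((i + 1 : ℕ) + 1)) := by
        push_cast
        have hi : (0 : ℝ) ≤ i := Nat.cast_nonneg i
        have e1 : (1 : ℝ) / (i + 1 + 1 - 1) * (4 / (9 * (i + 1 + 1) ^ 2)) =
          4 / (9 * (i + 1) * (i + 1 + 1) ^ 2) := by
          rw [add_sub_cancel_right]
          field_simp
        have e2 : (2 : ℝ) / 9 * (1 / (i + 1) - 1 / (i + 1 + 1)) = 2 /
            (9 * (i + 1) * (i + 1 + 1)) := by
          field_simp
          ring
        rw [e1, e2, div_le_div_iff₀ (by positivity) (by positivity)]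
        have : 0 ≤ ((i : ℝ) + 1) * (i + 1 + 1) * i := by positivity
        nlinarith
      linarith
  have h2 : ∑ p ∈ n.primesLE, 1 / ((p : ℝ) - 1) * (4 / (9 * (p : ℝ) ^ 2)) ≤
      ∑ k ∈ Icc 2 (n + 1), 1 / ((k : ℝ) - 1) * (4 / (9 * (k : ℝ) ^ 2)) := by
    refine sum_le_sum_of_subset_of_nonneg ?_ ?_
    · intro p hp
      rw [Nat.mem_primesLE] at hp
      exact mem_Icc.2 ⟨hp.2.two_le, by omega⟩
    · intro k hk _
      have : (2 : ℝ) ≤ k := by exact_mod_cast (mem_Icc.1 hk).1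
      have : 0 < (k : ℝ) - 1 := by linarith
      positivity
  have h3 : 0 ≤ 1 / ((n : ℝ) + 1) := by positivity
  linarith [h1 n]

open Finset in
theorem sum_sieveForm_le (R n : ℕ) :
    ∑ p ∈ n.primesLE, ∑ j ∈ Icc 1 (Nat.log p n), sieveForm R (p ^ j) ≤
      2 / 9 * sqfreeSum R + ∑ p ∈ n.primesLE, 1 / ((p : ℝ) - 1) * sqfreeTail R p := by
  have hF : 0 ≤ sqfreeSum R := sum_nonneg fun _ _ => by positivity
  have hT : ∀ p, 0 ≤ sqfreeTail R p := fun p => sum_nonneg fun _ _ => by positivity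
  have h1 : ∑ p ∈ n.primesLE, ∑ j ∈ Icc 1 (Nat.log p n), sieveForm R (p ^ j) ≤
      ∑ p ∈ n.primesLE, 1 / ((p : ℝ) - 1) * (4 / (9 * p ^ 2) * sqfreeSum R + sqfreeTail R p) := by
    refine sum_le_sum fun p hp => ?_
    have hp' := Nat.prime_of_mem_primesLE hp
    have hp1 : (1 : ℝ) < p := by exact_mod_cast hp'.one_lt
    calc _ ≤ ∑ j ∈ Icc 1 (Nat.log p n),
          ((p : ℝ) ^ j)⁻¹ * (4 / (9 * p ^ 2) * sqfreeSum R + sqfreeTail R p) :=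
          sum_le_sum fun j hj => sieveForm_prime_pow_le hp' (mem_Icc.1 hj).1
      _ ≤ _ := by
          rw [← sum_mul]
          have := hT p
          exact mul_le_mul_of_nonneg_right (sum_inv_pow_le hp1 _) (by positivity)
  refine h1.trans ?_
  simp only [mul_add, sum_add_distrib]
  gcongr
  calc _ = (∑ p ∈ n.primesLE, 1 / ((p : ℝ) - 1) * (4 / (9 * (p : ℝ) ^ 2))) * sqfreeSum R := by
        rw [sum_mul]
        exact sum_congr rfl fun _ _ => by ring
    _ ≤ _ := mul_le_mul_of_nonneg_right (sum_primesLE_inv_sq_le n) hF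

open Finset in
theorem exists_sum_inv_sub_one_le :
    ∃ C : ℝ, 0 ≤ C ∧ ∀ n : ℕ, 0 < n →
      ∑ p ∈ n.primesLE, 1 / ((p : ℝ) - 1) ≤ 0.02 * Real.log n + C := by
  obtain ⟨C, hC0, hC⟩ := exists_sum_log_div_sub_one_le
  obtain ⟨p₀, hp₀⟩ := exists_nat_ge (Real.exp 50)
  refine ⟨0.02 * C + p₀, by positivity, fun n hn => ?_⟩
  have h1 : ∑ p ∈ n.primesLE, 1 / ((p : ℝ) - 1) ≤
      ∑ p ∈ n.primesLE, (0.02 * (Real.log p / ((p : ℝ) - 1)) + if p < p₀ then 1 else 0) := by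
    refine sum_le_sum fun p hp => ?_
    have hp2 : (2 : ℝ) ≤ p := by exact_mod_cast (Nat.prime_of_mem_primesLE hp).two_le
    have hl : 0 ≤ Real.log p := Real.log_nonneg (by linarith)
    have hp1 : 0 < (p : ℝ) - 1 := by linarith
    split_ifs with h
    · have : 1 / ((p : ℝ) - 1) ≤ 1 := by
        rw [div_le_one hp1]
        linarith
      have : 0 ≤ Real.log p / ((p : ℝ) - 1) := by positivity
      linarith
    · have h2 : Real.exp 50 ≤ p := hp₀.trans (by exact_mod_cast not_lt.1 h)
      have h3 : 50 ≤ Real.log p := (Real.le_log_iff_exp_le (by linarith)).2 h2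
      rw [add_zero, ← mul_div_assoc]
      gcongr
      linarith
  refine h1.trans ?_
  rw [sum_add_distrib, ← mul_sum, ← sum_filter, sum_const, nsmul_eq_mul, mul_one]
  have h2 : (#{p ∈ n.primesLE | p < p₀} : ℝ) ≤ p₀ := by
    have : #{p ∈ n.primesLE | p < p₀} ≤ #(range p₀) := card_le_card fun p hp =>
      mem_range.2 (mem_filter.1 hp).2
    rw [card_range] at this
    exact_mod_cast this
  have := hC n hn
  linarith

open Finset in
theorem exists_sum_sqfreeTail_le :
    ∃ C : ℝ, 0 ≤ C ∧ ∀ R : ℕ, 1 < R →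
      ∑ p ∈ (R ^ 2).primesLE, 1 / ((p : ℝ) - 1) * sqfreeTail R p ≤
        1.02 * Real.log R + C + sqfreeSum R * (1 + C / Real.log R) := by
  obtain ⟨C₁, hC₁0, hC₁⟩ := exists_sum_log_div_sub_one_le
  obtain ⟨C₂, hC₂0, hC₂⟩ := exists_sum_inv_sub_one_le
  refine ⟨C₁ + C₂ + 1, by positivity, fun R hR => ?_⟩
  have hR0 : 0 < R := by omega
  have hlR : 0 < Real.log R := Real.log_pos (by exact_mod_cast hR)
  have hF : 0 ≤ sqfreeSum R := sum_nonneg fun _ _ => by positivity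
  have hsub : R.primesLE ⊆ (R ^ 2).primesLE := by
    intro p hp
    rw [Nat.mem_primesLE] at hp ⊢
    exact ⟨hp.1.trans (Nat.le_self_pow two_ne_zero R), hp.2⟩
  rw [← sum_sdiff hsub]
  have h1 : ∑ p ∈ R.primesLE, 1 / ((p : ℝ) - 1) * sqfreeTail R p ≤
      1.02 * Real.log R + (C₁ + C₂ + 1) := by
    calc _ ≤ ∑ p ∈ R.primesLE, (1 / ((p : ℝ) - 1) + Real.log p / ((p : ℝ) - 1)) := by
          refine sum_le_sum fun p hp => ?_
          have hp' := Nat.prime_of_mem_primesLE hp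
          have hp1 : (1 : ℝ) < p := by exact_mod_cast hp'.one_lt
          have : 0 < (p : ℝ) - 1 := by linarith
          calc _ ≤ 1 / ((p : ℝ) - 1) * (1 + Real.log p) := by
                gcongr
                exact sqfreeTail_le_log hR0 hp'.pos
            _ = _ := by ring
      _ ≤ _ := by
          rw [sum_add_distrib]
          linarith [hC₁ R hR0, hC₂ R hR0]
  have h2 : ∑ p ∈ (R ^ 2).primesLE \ R.primesLE, 1 / ((p : ℝ) - 1) * sqfreeTail R p ≤
      sqfreeSum R * (1 + (C₁ + C₂ + 1) / Real.log R) := by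
    have h3 : ∑ p ∈ (R ^ 2).primesLE \ R.primesLE, Real.log p / ((p : ℝ) - 1) ≤
        Real.log R + (C₁ + C₂ + 1) := by
      rw [sum_sdiff_eq_sub hsub]
      have h4 := hC₁ (R ^ 2) (by positivity)
      have h5 := log_le_sum_log_div_sub_one R hR0
      push_cast at h4
      rw [Real.log_pow] at h4
      push_cast at h4
      linarith
    calc _ ≤ ∑ p ∈ (R ^ 2).primesLE \ R.primesLE,
          sqfreeSum R / Real.log R * (Real.log p / ((p : ℝ) - 1)) := by
          refine sum_le_sum fun p hp => ?_
          rw [mem_sdiff, Nat.mem_primesLE, Nat.mem_primesLE] at hp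
          have hp' := hp.1.2
          have hp1 : (1 : ℝ) < p := by exact_mod_cast hp'.one_lt
          have hp1' : 0 < (p : ℝ) - 1 := by linarith
          have hRp : (R : ℝ) ≤ p := by
            have : R < p := by by_contra h; exact hp.2 ⟨not_lt.1 h, hp'⟩
            exact_mod_cast this.le
          have hl : Real.log R ≤ Real.log p := Real.log_le_log (by exact_mod_cast hR0) hRp
          calc _ ≤ 1 / ((p : ℝ) - 1) * sqfreeSum R := by
                gcongr
                exact sqfreeTail_le_sqfreeSum R p
            _ = sqfreeSum R / Real.log R * (Real.log R / ((p : ℝ) - 1)) := by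
                field_simp
            _ ≤ _ := by gcongr
      _ = sqfreeSum R / Real.log R *
          ∑ p ∈ (R ^ 2).primesLE \ R.primesLE, (Real.log p / ((p : ℝ) - 1)) := by rw [mul_sum]
      _ ≤ sqfreeSum R / Real.log R * (Real.log R + (C₁ + C₂ + 1)) := by gcongr
      _ = _ := by field_simp
  linarith

open Finset in
theorem eventually_one_le_sieve :
    ∀ᶠ R : ℕ in Filter.atTop, 1 ≤ 3 * sieveForm R 1 -
      ∑ p ∈ (R ^ 2).primesLE, ∑ j ∈ Icc 1 (Nat.log p (R ^ 2)), sieveForm R (p ^ j) := by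
  obtain ⟨C, hC0, hC⟩ := exists_sum_sqfreeTail_le
  have hlog : Filter.Tendsto (fun R : ℕ => Real.log R) Filter.atTop Filter.atTop :=
    Real.tendsto_log_atTop.comp tendsto_natCast_atTop_atTop
  filter_upwards [Filter.eventually_gt_atTop 1,
    hlog.eventually_ge_atTop (100 * (C + 1)), hlog.eventually_ge_atTop (100 * (C + 1) * 1.66)]
    with R hR h1 h2
  have h3 := sum_sieveForm_le R (R ^ 2)
  have h4 := hC R hR
  have h5 := log_le_sqfreeSum R (by omega)
  have h6 : C / Real.log R ≤ 0.01 := by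
    rw [div_le_iff₀ (by linarith)]
    linarith
  have hF : 0 ≤ sqfreeSum R := sum_nonneg fun _ _ => by positivity
  have h7 := mul_le_mul_of_nonneg_left h6 hF
  rw [sieveForm_one]
  nlinarith

theorem sqrt_two_mul_le {N : ℝ} (hN : 0 ≤ N) : √(2 * N) ≤ 3 / 2 * √N := by
  rw [Real.sqrt_le_left (by positivity), mul_pow, Real.sq_sqrt hN]
  linarith

theorem abs_sqrt_sub_sqrt_ge {N b b' : ℕ} (hN : 0 < N) (hb : b ≤ 2 * N) (hb' : b' ≤ 2 * N)
    (hne : b ≠ b') : 1 / (3 * √(N : ℝ)) ≤ |√(b : ℝ) - √(b' : ℝ)| := by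
  have hN0 : (0 : ℝ) < N := by exact_mod_cast hN
  have hs : 0 < √(N : ℝ) := Real.sqrt_pos.2 hN0
  have hle : ∀ c : ℕ, c ≤ 2 * N → √(c : ℝ) ≤ 3 / 2 * √(N : ℝ) := fun c hc =>
    (Real.sqrt_le_sqrt (by exact_mod_cast hc)).trans (sqrt_two_mul_le hN0.le)
  have h1 : (1 : ℝ) ≤ |(b : ℝ) - b'| := by
    have : (1 : ℤ) ≤ |(b : ℤ) - b'| := Int.one_le_abs (by omega)
    exact_mod_cast this
  have h2 : (b : ℝ) - b' = (√(b : ℝ) - √(b' : ℝ)) * (√(b : ℝ) + √(b' : ℝ)) := by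
    have e1 := Real.sq_sqrt (Nat.cast_nonneg (α := ℝ) b)
    have e2 := Real.sq_sqrt (Nat.cast_nonneg (α := ℝ) b')
    ring_nf
    rw [e1, e2]
  have h3 : 0 ≤ √(b : ℝ) + √(b' : ℝ) := by positivity
  rw [h2, abs_mul, abs_of_nonneg h3] at h1
  rw [div_le_iff₀ (by positivity)]
  refine h1.trans ?_
  gcongr
  linarith [hle b hb, hle b' hb']

theorem sq_le_of_lt_abs_sq_sub_sq {u v s d V T : ℝ} (hu0 : 0 ≤ u) (hv0 : 0 ≤ v) (hs : 0 < s)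
    (hd : 0 < d)
    (hV : 0 < V) (hT : 0 < T) (hu : u ≤ d * V * T * (3 / 2 * s)) (hv : v ≤ d * V * T * (3 / 2 * s))
    (h : 3 * d ^ 2 * V * T ^ 2 < |u ^ 2 - v ^ 2|) :
    T ^ 2 ≤ Real.pi * (2 * s) ^ 2 * (u / d - v / d) ^ 2 := by
  have hpi := Real.pi_gt_three
  have h2 : u + v ≤ 3 * s * (d * V * T) := by linarith
  have h3 : |u ^ 2 - v ^ 2| = |u - v| * (u + v) := by
    rw [show u ^ 2 - v ^ 2 = (u - v) * (u + v) by ring, abs_mul, abs_of_nonneg (add_nonneg hu0 hv0)]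
  have h4 : d * T < |u - v| * s := by
    by_contra h5
    rw [not_lt] at h5
    have h6 : |u - v| * (u + v) ≤ |u - v| * (3 * s * (d * V * T)) := by gcongr
    have h7 : |u - v| * s * (3 * (d * V * T)) ≤ d * T * (3 * (d * V * T)) := by gcongr
    nlinarith
  have e : Real.pi * (2 * s) ^ 2 * (u / d - v / d) ^ 2 =
      4 * Real.pi * (|u - v| * s) ^ 2 / d ^ 2 := by
    rw [mul_pow |u - v|, sq_abs]
    field_simp
    ring
  rw [e, le_div_iff₀ (by positivity)]
  have h6 : (d * T) ^ 2 ≤ (|u - v| * s) ^ 2 := pow_le_pow_left₀ (by positivity) h4.le 2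
  nlinarith [sq_nonneg (|u - v| * s)]

set_option maxHeartbeats 1000000 in
open Finset in
theorem sum_norm_sq_exp_sum_le (N G : ℕ) (A B : Finset ℕ) (V T d θ : ℝ) (c : ℕ → ℂ)
    (hN : 4 ≤ N) (hG : 0 < G) (hA : A ⊆ Icc (N + 1) (2 * N)) (hB : B ⊆ Icc (N + 1) (2 * N))
    (hV : 1 ≤ V) (hVN : V ≤ N) (hT : 1 ≤ T) (hd : 1 ≤ d) (hdV : (d * V) ^ 2 ≤ N)
    (hGd : (G : ℝ) ≤ d * V * T) (hTexp : Real.exp (-T ^ 2) * (N : ℝ) ^ 2 ≤ 1)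
    (hlog : 1 + Real.log G ≤ T) (hc : ∀ h, ‖c h‖ ≤ 1) (hθ : |θ| = 1) :
    ∑ b ∈ B, ‖∑ j ∈ Icc 1 G ×ˢ A, c j.1 * expChar (j.1 * √(j.2 : ℝ) / d * (θ * √(b : ℝ)))‖ ^ 2 ≤
      12 * Real.exp Real.pi * 132 * (d ^ 2 * N ^ 2 * V ^ 2 * T ^ 6) := by
  have hN0 : (0 : ℝ) < N := by exact_mod_cast (show 0 < N by omega)
  have hN4 : (4 : ℝ) ≤ N := by exact_mod_cast hN
  set s := √(N : ℝ) with hs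
  have hs2 : s ^ 2 = N := Real.sq_sqrt hN0.le
  have hs4 : 2 ≤ s := by
    rw [hs]
    exact Real.le_sqrt_of_sq_le (by linarith)
  have hle : ∀ c : ℕ, c ∈ Icc (N + 1) (2 * N) → √(c : ℝ) ≤ 3 / 2 * s := fun c hc =>
    (Real.sqrt_le_sqrt (by exact_mod_cast (mem_Icc.1 hc).2)).trans (sqrt_two_mul_le hN0.le)
  set X : ℝ := 2 * s * V * T with hX
  set L : ℝ := 2 * s with hL
  have hVT : 1 ≤ V * T := by nlinarith
  have hXs : 2 * s ≤ X := by rw [hX]; nlinarith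
  have hX0 : 0 < X := by linarith
  set J := Icc 1 G ×ˢ A with hJ
  have hj : ∀ j ∈ J, (j.1 : ℝ) * √(j.2 : ℝ) ≤ d * V * T * (3 / 2 * s) := by
    intro j hj
    rw [hJ, mem_product] at hj
    have h1 : (j.1 : ℝ) ≤ d * V * T :=
      le_trans (by exact_mod_cast (mem_Icc.1 hj.1).2) hGd
    have h2 := hle j.2 (hA hj.2)
    gcongr
  have key := double_large_sieve J B (fun j => c j.1) (fun j => j.1 * √(j.2 : ℝ) / d)
    (fun b => θ * √(b : ℝ)) hX0 (show 0 < L by positivity) ?_ ?_ ?_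
  · refine key.trans ?_
    set D : ℕ := ⌊3 * d ^ 2 * V * T ^ 2⌋₊ with hD
    have hcount : ∑ j ∈ J, ∑ k ∈ J, ‖c j.1‖ * ‖c k.1‖ *
        Real.exp (-Real.pi * L ^ 2 * (j.1 * √(j.2 : ℝ) / d - k.1 * √(k.2 : ℝ) / d) ^ 2) ≤
        33 * (d ^ 2 * N * V * T ^ 5) := by
      have hterm : ∀ j ∈ J, ∀ k ∈ J, ‖c j.1‖ * ‖c k.1‖ *
          Real.exp (-Real.pi * L ^ 2 * (j.1 * √(j.2 : ℝ) / d - k.1 * √(k.2 : ℝ) / d) ^ 2) ≤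
          (if |(j.1 : ℤ) ^ 2 * (j.2 : ℤ) - (k.1 : ℤ) ^ 2 * (k.2 : ℤ)| ≤
              (D : ℤ) then (1 : ℝ) else 0) +
            Real.exp (-T ^ 2) := by
        intro j hjm k hkm
        have h0 : ‖c j.1‖ * ‖c k.1‖ ≤ 1 := mul_le_one₀ (hc _) (norm_nonneg _) (hc _)
        set u := (j.1 : ℝ) * √(j.2 : ℝ) with hu
        set v := (k.1 : ℝ) * √(k.2 : ℝ) with hv
        have hpi := Real.pi_gt_three
        split_ifs with hclose
        · have h1 : Real.exp (-Real.pi * L ^ 2 * (u / d - v / d) ^ 2) ≤ 1 := by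
            rw [Real.exp_le_one_iff]
            have : 0 ≤ Real.pi * L ^ 2 * (u / d - v / d) ^ 2 := by positivity
            linarith
          have h2 := mul_le_one₀ h0 (Real.exp_pos _).le h1
          linarith [Real.exp_pos (-T ^ 2)]
        · have h1 : 3 * d ^ 2 * V * T ^ 2 < |u ^ 2 - v ^ 2| := by
            rw [hu, hv, mul_pow, mul_pow, Real.sq_sqrt (Nat.cast_nonneg _),
              Real.sq_sqrt (Nat.cast_nonneg _)]
            have h2 : ((D + 1 : ℕ) : ℤ) ≤
                |(j.1 : ℤ) ^ 2 * (j.2 : ℤ) - (k.1 : ℤ) ^ 2 * (k.2 : ℤ)| := by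
              push_cast
              omega
            have h3 : ((D + 1 : ℕ) : ℝ) ≤
                |(j.1 : ℝ) ^ 2 * (j.2 : ℝ) - (k.1 : ℝ) ^ 2 * (k.2 : ℝ)| := by
              exact_mod_cast h2
            have h4 := Nat.lt_floor_add_one (3 * d ^ 2 * V * T ^ 2)
            rw [← hD] at h4
            push_cast at h3
            linarith
          have h5 := sq_le_of_lt_abs_sq_sub_sq (by positivity) (by positivity) (by linarith)
              (by linarith)
            (by linarith) (by linarith) (hj j hjm) (hj k hkm) h1
          rw [← hL] at h5
          have h6 : Real.exp (-Real.pi * L ^ 2 * (u / d - v / d) ^ 2) ≤ Real.exp (-T ^ 2) := by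
            apply Real.exp_le_exp.2
            linarith
          calc _ ≤ 1 * Real.exp (-T ^ 2) := by gcongr
            _ = _ := by ring
      have hcard : (#J : ℝ) ≤ G * N := by
        rw [hJ, card_product]
        have : #A ≤ N := by
          refine (card_le_card hA).trans ?_
          rw [Nat.card_Icc]
          omega
        push_cast
        rw [Nat.card_Icc, Nat.add_sub_cancel]
        gcongr
      have hcl := card_sq_mul_close_le N G D hG
      have hD1 : (D : ℝ) ≤ 3 * d ^ 2 * V * T ^ 2 := Nat.floor_le (by positivity)
      have h1 : ∑ j ∈ J, ∑ k ∈ J,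
          (if |(j.1 : ℤ) ^ 2 * (j.2 : ℤ) - (k.1 : ℤ) ^ 2 * (k.2 : ℤ)| ≤
              (D : ℤ) then (1 : ℝ) else 0) ≤
          4 * (1 + Real.log G) * (D * N + D * G ^ 2 + N * G + G ^ 2) := by
        refine le_trans ?_ hcl
        rw [← sum_product', card_filter]
        push_cast
        refine sum_le_sum_of_subset_of_nonneg ?_ (fun _ _ _ => by positivity)
        exact product_subset_product (product_subset_product_right hA)
          (product_subset_product_right hA)
      have hT2 : T ^ 2 ≤ T ^ 4 := pow_le_pow_right₀ hT (by norm_num)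
      have hT1 : T ≤ T ^ 4 := le_self_pow₀ hT (by norm_num)
      have hdd : d ≤ d ^ 2 := le_self_pow₀ hd (by norm_num)
      have hN1 : (1 : ℝ) ≤ N := by linarith
      have hG2 : (G : ℝ) ^ 2 ≤ (d * V * T) ^ 2 := by gcongr
      have b1 : (D : ℝ) * N ≤ 3 * (d ^ 2 * N * V * T ^ 4) := by
        calc (D : ℝ) * N ≤ 3 * d ^ 2 * V * T ^ 2 * N := by gcongr
          _ ≤ 3 * d ^ 2 * V * T ^ 4 * N := by gcongr
          _ = _ := by ring
      have b2 : (D : ℝ) * G ^ 2 ≤ 3 * (d ^ 2 * N * V * T ^ 4) := by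
        calc (D : ℝ) * G ^ 2 ≤ 3 * d ^ 2 * V * T ^ 2 * (d * V * T) ^ 2 := by gcongr
          _ = 3 * d ^ 2 * V * T ^ 4 * (d * V) ^ 2 := by ring
          _ ≤ 3 * d ^ 2 * V * T ^ 4 * N := by gcongr
          _ = _ := by ring
      have b3 : (N : ℝ) * G ≤ d ^ 2 * N * V * T ^ 4 := by
        calc (N : ℝ) * G ≤ N * (d * V * T) := by gcongr
          _ ≤ N * (d ^ 2 * V * T ^ 4) := by gcongr
          _ = _ := by ring
      have b4' : (G : ℝ) ^ 2 ≤ d ^ 2 * N * V * T ^ 2 := by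
        calc (G : ℝ) ^ 2 ≤ d ^ 2 * V * V * T ^ 2 := by
              rw [show d ^ 2 * V * V * T ^ 2 = (d * V * T) ^ 2 by ring]
              exact hG2
          _ ≤ d ^ 2 * N * V * T ^ 2 := by gcongr
      have b4 : (G : ℝ) ^ 2 ≤ d ^ 2 * N * V * T ^ 4 := b4'.trans (by gcongr)
      have hlog0 : 0 ≤ 1 + Real.log G := by linarith [Real.log_natCast_nonneg G]
      calc _ ≤ ∑ j ∈ J, ∑ k ∈ J,
          ((if |(j.1 : ℤ) ^ 2 * (j.2 : ℤ) - (k.1 : ℤ) ^ 2 * (k.2 : ℤ)| ≤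
              (D : ℤ) then (1 : ℝ) else 0) +
            Real.exp (-T ^ 2)) := sum_le_sum fun j hj => sum_le_sum fun k hk => hterm j hj k hk
        _ = _ + (#J : ℝ) ^ 2 * Real.exp (-T ^ 2) := by
            simp only [sum_add_distrib, sum_const, nsmul_eq_mul]
            ring
        _ ≤ 4 * (1 + Real.log G) * (D * N + D * G ^ 2 + N * G + G ^ 2) +
            (G * N) ^ 2 * Real.exp (-T ^ 2) := by gcongr
        _ ≤ 4 * T * (8 * (d ^ 2 * N * V * T ^ 4)) + G ^ 2 * 1 := by
            have e : ((G : ℝ) * N) ^ 2 * Real.exp (-T ^ 2) = G ^ 2 *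
                (Real.exp (-T ^ 2) * N ^ 2) := by ring
            rw [e]
            gcongr
            linarith
        _ ≤ 4 * T * (8 * (d ^ 2 * N * V * T ^ 4)) + d ^ 2 * N * V * T ^ 5 := by
            have : d ^ 2 * N * V * T ^ 2 ≤ d ^ 2 * N * V * T ^ 5 := by
              gcongr
              norm_num
            linarith
        _ = _ := by ring
    calc _ ≤ 12 * Real.exp Real.pi * X * L * (33 * (d ^ 2 * N * V * T ^ 5)) := by gcongr
      _ = 12 * Real.exp Real.pi * 132 * (d ^ 2 * (N * s ^ 2) * V ^ 2 * T ^ 6) := by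
        rw [hX, hL]
        ring
      _ = _ := by rw [hs2]; ring
  · intro j hjm
    rw [abs_of_nonneg (by positivity), div_le_iff₀ (by linarith)]
    refine (hj j hjm).trans ?_
    rw [hX]
    have : 0 ≤ d * V * T * s := by positivity
    nlinarith
  · intro b hb
    rw [abs_mul, hθ, one_mul, abs_of_nonneg (Real.sqrt_nonneg _)]
    have h1 := hle b (hB hb)
    have h2 : 1 / (6 * X) ≤ 1 := by
      rw [div_le_one (by positivity)]
      linarith
    rw [hL]
    linarith
  · intro b hb b' hb' hne
    rw [← mul_sub, abs_mul, hθ, one_mul]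
    refine le_trans ?_ (abs_sqrt_sub_sqrt_ge (by omega) (mem_Icc.1 (hB hb)).2
      (mem_Icc.1 (hB hb')).2 hne)
    apply one_div_le_one_div_of_le (by positivity)
    rw [← hs]
    linarith

theorem sum_Icc_neg_natCast {M : Type*} [AddCommMonoid M] (F : ℤ → M) (G : ℕ) :
    ∑ h ∈ Finset.Icc (-G : ℤ) G, F h = F 0 + ∑ h ∈ Finset.Icc 1 G, (F h + F (-h)) := by
  induction G with
  | zero => simp
  | succ n ih =>
    rw [Finset.sum_Icc_succ_top (by omega), ← add_assoc, ← ih]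
    have h1 : Finset.Icc (-((n + 1 : ℕ) : ℤ)) ((n + 1 : ℕ) : ℤ) =
        insert ((n + 1 : ℕ) : ℤ) (insert (-((n + 1 : ℕ) : ℤ)) (Finset.Icc (-n : ℤ) n)) := by
      ext x
      simp only [Finset.mem_Icc, Finset.mem_insert]
      push_cast
      omega
    rw [h1, Finset.sum_insert, Finset.sum_insert, ← add_assoc, add_comm]
    · simp
    · simp only [Finset.mem_insert, Finset.mem_Icc]
      push_cast
      omega

open scoped SchwartzMap FourierTransform in
theorem fourier_comp_div (K : ℝ → ℂ) {s : ℝ} (hs : 0 < s) (w : ℝ) :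
    𝓕 (fun x => K (x / s)) w = s * 𝓕 K (s * w) := by
  rw [Real.fourier_real_eq_integral_exp_smul, Real.fourier_real_eq_integral_exp_smul]
  have := MeasureTheory.Measure.integral_comp_div
    (fun v : ℝ => Complex.exp ((-2 * Real.pi * v * (s * w) : ℝ) * Complex.I) • K v) s
  rw [abs_of_pos hs, Complex.real_smul] at this
  rw [← this]
  congr 1
  ext v
  congr 4
  field_simp

open scoped SchwartzMap FourierTransform in
theorem tsum_schwartz_comp_eq (K : 𝓢(ℝ, ℂ)) {s : ℝ} (hs : 0 < s) (t : ℝ) :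
    ∑' n : ℤ, K ((n - t) / s) = s * ∑' h : ℤ, 𝓕 K (s * h) * expChar (-(h * t)) := by
  let g : ℝ ≃L[ℝ] ℝ := ContinuousLinearEquiv.unitsEquivAut ℝ (Units.mk0 s⁻¹ (inv_ne_zero hs.ne'))
  let f : 𝓢(ℝ, ℂ) := SchwartzMap.compCLMOfContinuousLinearEquiv ℂ g K
  have hf : ∀ x, f x = K (x / s) := fun x => rfl
  have hF : ∀ w : ℝ, 𝓕 f w = s * 𝓕 K (s * w) := fun w => by
    rw [SchwartzMap.fourier_coe, SchwartzMap.fourier_coe, ← fourier_comp_div _ hs]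
    rfl
  have key := SchwartzMap.tsum_eq_tsum_fourier f (-t)
  rw [← tsum_mul_left]
  refine (tsum_congr fun n => ?_).trans (key.trans (tsum_congr fun h => ?_))
  · rw [hf]
    congr 1
    ring
  · rw [hF, mul_assoc]
    congr 2
    symm
    rw [fourier_coe_apply, expChar]
    congr 1
    push_cast
    ring

open scoped SchwartzMap FourierTransform in
theorem exists_norm_fourier_le (K : 𝓢(ℝ, ℂ)) (J : ℕ) :
    ∃ C > 0, ∀ x, |x| ^ J * ‖𝓕 K x‖ ≤ C := by
  obtain ⟨C, hC, h⟩ := (𝓕 K).decay J 0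
  refine ⟨C, hC, fun x => ?_⟩
  simpa using h x

open scoped SchwartzMap FourierTransform in
theorem exists_norm_tsum_sub_le (K : 𝓢(ℝ, ℂ)) (J : ℕ) : ∃ C > 0, ∀ s Y t : ℝ, 0 < s → 0 < Y →
    ∀ G : ℕ, Y ≤ s * (G + 1) →
    ‖∑' n : ℤ, K ((n - t) / s) - s * (𝓕 K 0 + ∑ h ∈ Finset.Icc 1 G,
      (𝓕 K (s * h) * expChar (-(h * t)) + 𝓕 K (-(s * h)) * expChar (h * t)))‖ ≤
          C / (s * Y ^ J) := by
  obtain ⟨C, hC, hK⟩ := exists_norm_fourier_le K (J + 2)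
  have hz : Summable fun h : ℤ => ((h : ℝ) ^ 2)⁻¹ := by
    simpa using Real.summable_one_div_int_pow.2 (show 1 < 2 by norm_num)
  set Z := ∑' h : ℤ, ((h : ℝ) ^ 2)⁻¹ with hZ
  have hZ0 : 0 < Z := hz.tsum_pos (fun h => by positivity) 1 (by norm_num)
  refine ⟨C * Z, by positivity, fun s Y t hs hY G hG => ?_⟩
  rw [tsum_schwartz_comp_eq K hs]
  set F : ℤ → ℂ := fun h => 𝓕 K (s * h) * expChar (-(h * t)) with hF
  have hFb : ∀ h : ℤ, |s * h| ^ (J + 2) * ‖F h‖ ≤ C := fun h => by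
    rw [hF]
    simp only [norm_mul, norm_expChar, mul_one]
    exact hK _
  have hF2 : ∀ h : ℤ, h ∉ Finset.Icc (-G : ℤ) G → ‖F h‖ ≤
      C / (s ^ 2 * Y ^ J) * ((h : ℝ) ^ 2)⁻¹ := by
    intro h hh
    have h1 : (G : ℝ) + 1 ≤ |(h : ℝ)| := by
      have : (G : ℤ) + 1 ≤ |h| := by
        rw [Finset.mem_Icc] at hh
        rcases le_or_gt 0 h with h0 | h0
        · rw [abs_of_nonneg h0]; omega
        · rw [abs_of_neg h0]; omega
      exact_mod_cast this
    have h2 : Y ≤ |s * h| := by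
      rw [abs_mul, abs_of_pos hs]
      exact hG.trans (by gcongr)
    have h3 : (0 : ℝ) < (h : ℝ) ^ 2 := by
      rw [← sq_abs]
      have : (0 : ℝ) ≤ G := by positivity
      have : 0 < |(h : ℝ)| := by linarith
      positivity
    rw [← div_eq_mul_inv, div_div, le_div_iff₀ (by positivity)]
    refine le_trans ?_ (hFb h)
    rw [pow_add, sq_abs, mul_pow s, mul_comm]
    have : Y ^ J ≤ |s * h| ^ J := pow_le_pow_left₀ hY.le h2 J
    calc s ^ 2 * Y ^ J * h ^ 2 * ‖F h‖ = Y ^ J * (s ^ 2 * h ^ 2) * ‖F h‖ := by ring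
      _ ≤ _ := by gcongr
  have hu : Summable fun h : ℤ => C / (s ^ 2 * Y ^ J) * ((h : ℝ) ^ 2)⁻¹ := hz.mul_left _
  have hsF : Summable F := by
    refine .of_norm_bounded_eventually hu ?_
    filter_upwards [(Finset.Icc (-G : ℤ) G).finite_toSet.compl_mem_cofinite] with h hh
    exact hF2 h (by simpa using hh)
  have e1 : 𝓕 K 0 + ∑ h ∈ Finset.Icc 1 G,
      (𝓕 K (s * h) * expChar (-(h * t)) + 𝓕 K (-(s * h)) * expChar (h * t)) =
      ∑ h ∈ Finset.Icc (-G : ℤ) G, F h := by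
    rw [sum_Icc_neg_natCast, hF]
    simp [expChar]
  rw [e1, ← hsF.sum_add_tsum_subtype_compl (Finset.Icc (-G : ℤ) G), ← mul_sub, add_sub_cancel_left,
    norm_mul, Complex.norm_real, Real.norm_of_nonneg hs.le]
  have h4 : ‖∑' h : { h // h ∉ Finset.Icc (-G : ℤ) G }, F h‖ ≤ C / (s ^ 2 * Y ^ J) * Z := by
    rw [hZ, ← tsum_mul_left]
    refine (tsum_of_norm_bounded (hu.subtype {h | h ∉ Finset.Icc (-G : ℤ) G}).hasSum
      fun h => hF2 _ h.2).trans ?_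
    exact hu.tsum_subtype_le _ _ fun h => by positivity
  calc _ ≤ s * (C / (s ^ 2 * Y ^ J) * Z) := by gcongr
    _ = _ := by field_simp

open scoped SchwartzMap FourierTransform in
theorem exists_bump : ∃ K : 𝓢(ℝ, ℂ), ∃ k : ℝ → ℝ, ∃ κ : ℝ, (∀ x, K x = k x) ∧ (∀ x, 0 ≤ k x) ∧
    (∀ x, 1 ≤ |x| → k x = 0) ∧ 0 < κ ∧ 𝓕 K 0 = κ := by
  let f : ContDiffBump (0 : ℝ) := ⟨1 / 2, 1, by norm_num, by norm_num⟩
  have hc : HasCompactSupport fun x => (f x : ℂ) :=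
      f.hasCompactSupport.comp_left Complex.ofReal_zero
  have hd : ContDiff ℝ (⊤ : ℕ∞) fun x => (f x : ℂ) := Complex.ofRealCLM.contDiff.comp f.contDiff
  refine ⟨hc.toSchwartzMap hd, f, ∫ x, f x, fun x => rfl, fun x => f.nonneg, fun x hx => ?_,
    f.integral_pos, ?_⟩
  · exact f.zero_of_le_dist (by simpa [Real.dist_eq] using hx)
  · rw [SchwartzMap.fourier_coe, Real.fourier_real_eq_integral_exp_smul, ← integral_complex_ofReal]
    congr 1
    ext x
    simp

open Finset in
open scoped SchwartzMap FourierTransform in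
theorem sum_multiples_eq_tsum (K : 𝓢(ℝ, ℂ)) (hK : ∀ x, 1 ≤ |x| → K x = 0) {N d : ℕ} {x V : ℝ}
    (hx : (N : ℝ) + 1 ≤ x) (hx' : x ≤ 2 * N) (hd : 0 < d) (hV : 1 ≤ V) :
    ∑ P ∈ Icc 1 (3 * N) with d ∣ P, K ((P - x) * V) =
      ∑' n : ℤ, K ((n - x / d) / (1 / (d * V))) := by
  have hd0 : (0 : ℝ) < d := by exact_mod_cast hd
  have harg : ∀ n : ℤ, ((n : ℝ) - x / d) / (1 / (d * V)) = (d * n - x) * V := fun n => by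
    field_simp
  rw [tsum_eq_sum (s := {P ∈ Icc 1 (3 * N) | d ∣ P}.image fun P => ((P / d : ℕ) : ℤ)), sum_image]
  · refine sum_congr rfl fun P hP => ?_
    obtain ⟨m, rfl⟩ := (mem_filter.1 hP).2
    rw [harg, Nat.mul_div_cancel_left m hd]
    push_cast
    rfl
  · intro P hP Q hQ h
    obtain ⟨m, rfl⟩ := (mem_filter.1 hP).2
    obtain ⟨n, rfl⟩ := (mem_filter.1 hQ).2
    simp only [Nat.mul_div_cancel_left _ hd] at h
    rw [Nat.cast_injective h]
  · intro n hn
    rw [harg]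
    refine hK _ ?_
    by_contra hlt
    rw [not_le, abs_mul, abs_of_pos (by linarith : 0 < V)] at hlt
    have h1 : |(d : ℝ) * n - x| < 1 := by nlinarith [abs_nonneg ((d : ℝ) * n - x)]
    rw [abs_lt] at h1
    have h2 : ((0 : ℤ) : ℝ) < (d * n : ℤ) := by push_cast; linarith [Nat.cast_nonneg (α := ℝ) N]
    have h3 : ((d * n : ℤ) : ℝ) < (2 * N + 1 : ℤ) := by push_cast; linarith
    rw [Int.cast_lt] at h2 h3
    have hn0 : 0 < n := by
      by_contra h0
      nlinarith
    lift n to ℕ using hn0.le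
    refine hn (mem_image.2 ⟨d * n, mem_filter.2 ⟨mem_Icc.2 ⟨?_, ?_⟩, dvd_mul_right _ _⟩, ?_⟩)
    · exact_mod_cast h2
    · have : 0 < N := by
        have : (0 : ℝ) < N := by linarith
        exact_mod_cast this
      have : d * n < 2 * N + 1 := by exact_mod_cast h3
      omega
    · rw [Nat.mul_div_cancel_left _ hd]

open Finset in
theorem sum_norm_exp_sum_le (N G : ℕ) (A B : Finset ℕ) (V T d θ M : ℝ) (c : ℕ → ℂ)
    (hN : 4 ≤ N) (hG : 0 < G) (hA : A ⊆ Icc (N + 1) (2 * N)) (hB : B ⊆ Icc (N + 1) (2 * N))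
    (hV : 1 ≤ V) (hVN : V ≤ N) (hT : 1 ≤ T) (hd : 1 ≤ d) (hdV : (d * V) ^ 2 ≤ N)
    (hGd : (G : ℝ) ≤ d * V * T) (hTexp : Real.exp (-T ^ 2) * (N : ℝ) ^ 2 ≤ 1)
    (hlog : 1 + Real.log G ≤ T) (hM : 0 < M) (hc : ∀ h, ‖c h‖ ≤ M) (hθ : |θ| = 1) :
    ∑ b ∈ B, ‖∑ j ∈ Icc 1 G ×ˢ A, c j.1 * expChar (j.1 * √(j.2 : ℝ) / d * (θ * √(b : ℝ)))‖ ≤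
      M * √(12 * Real.exp Real.pi * 132) * (√(#B : ℝ) * (d * N * V * T ^ 3)) := by
  set c' : ℕ → ℂ := fun h => c h / M with hc'
  have h1 := sum_norm_sq_exp_sum_le N G A B V T d θ c' hN hG hA hB hV hVN hT hd hdV hGd hTexp hlog
    (fun h => by
      rw [hc', norm_div, Complex.norm_real, Real.norm_of_nonneg hM.le, div_le_one hM]
      exact hc h) hθ
  set E : ℕ → ℂ := fun b => ∑ j ∈ Icc 1 G ×ˢ A, c' j.1 * expChar
      (j.1 * √(j.2 : ℝ) / d * (θ * √(b : ℝ)))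
    with hE
  have h2 : ∀ b : ℕ, ‖∑ j ∈ Icc 1 G ×ˢ A, c j.1 * expChar (j.1 * √(j.2 : ℝ) / d * (θ * √(b : ℝ)))‖ =
      M * ‖E b‖ := by
    intro b
    rw [← Real.norm_of_nonneg hM.le, ← Complex.norm_real, ← norm_mul, hE, mul_sum]
    congr 1
    refine sum_congr rfl fun j _ => ?_
    have : (M : ℂ) ≠ 0 := by exact_mod_cast hM.ne'
    rw [hc']
    field_simp
  simp only [h2]
  rw [← mul_sum, mul_assoc]
  gcongr
  have h3 : (∑ b ∈ B, ‖E b‖) ^ 2 ≤ #B * ∑ b ∈ B, ‖E b‖ ^ 2 := sq_sum_le_card_mul_sum_sq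
  rw [← sq_le_sq₀ (sum_nonneg fun _ _ => norm_nonneg _) (by positivity)]
  refine h3.trans ?_
  rw [mul_pow, mul_pow, Real.sq_sqrt (by positivity), Real.sq_sqrt (by positivity)]
  calc _ ≤ (#B : ℝ) * (12 * Real.exp Real.pi * 132 * (d ^ 2 * N ^ 2 * V ^ 2 * T ^ 6)) := by gcongr
    _ = _ := by ring

open Finset in
open scoped SchwartzMap FourierTransform in
theorem exists_discrepancy_le (K : 𝓢(ℝ, ℂ)) (k : ℝ → ℝ) (κ : ℝ) (hKk : ∀ x, K x = k x)
    (hK : ∀ x, 1 ≤ |x| → k x = 0) (hκ : 𝓕 K 0 = κ) (J : ℕ) : ∃ C > 0,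
    ∀ (N d : ℕ) (A B : Finset ℕ) (V T : ℝ), 4 ≤ N → A ⊆ Icc (N + 1) (2 * N) →
      B ⊆ Icc (N + 1) (2 * N) → 1 ≤ V → 1 ≤ T → 1 ≤ d → (d * V) ^ 2 ≤ N →
      Real.exp (-T ^ 2) * (N : ℝ) ^ 2 ≤ 1 → 1 + Real.log (d * V * T) ≤ T → N ≤ T ^ J →
      |∑ a ∈ A, ∑ b ∈ B, ∑ P ∈ Icc 1 (3 * N) with d ∣ P, k ((P - √(a : ℝ) * √(b : ℝ)) * V) -
        κ * (#A * #B) / (d * V)| ≤ C * (√(#B : ℝ) * N * T ^ 3) := by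
  obtain ⟨C, hC, hPoisson⟩ := exists_norm_tsum_sub_le K J
  obtain ⟨M, hM, hMK⟩ := exists_norm_fourier_le K 0
  simp only [pow_zero, one_mul] at hMK
  set Q := √(12 * Real.exp Real.pi * 132) with hQ
  refine ⟨C + 2 * (M * Q), by positivity, fun N d A B V T hN hA hB hV hT hd hdV hTexp hlog hTJ =>
    ?_⟩
  have hd1 : (1 : ℝ) ≤ d := by exact_mod_cast hd
  have hN4 : (4 : ℝ) ≤ N := by exact_mod_cast hN
  have hdV1 : 1 ≤ d * V := one_le_mul_of_one_le_of_one_le hd1 hV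
  have hdVN : d * V ≤ N := by nlinarith
  have hVN : V ≤ N := by nlinarith
  set s : ℝ := 1 / (d * V) with hs
  have hs0 : 0 < s := by positivity
  set G := ⌊d * V * T⌋₊ with hG
  have hGle : (G : ℝ) ≤ d * V * T := Nat.floor_le (by positivity)
  have hG0 : 0 < G := Nat.floor_pos.2 (one_le_mul_of_one_le_of_one_le hdV1 hT)
  have hsG : T ≤ s * (G + 1) := by
    have := Nat.lt_floor_add_one (d * V * T)
    rw [hs, one_div, inv_mul_eq_div, le_div_iff₀ (by positivity)]
    linarith
  have hlogG : 1 + Real.log G ≤ T := by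
    have : Real.log G ≤ Real.log (d * V * T) :=
      Real.log_le_log (by exact_mod_cast hG0) hGle
    linarith
  have hx : ∀ a ∈ Icc (N + 1) (2 * N), √((N : ℝ) + 1) ≤ √(a : ℝ) ∧ √(a : ℝ) ≤ √(2 * N) := by
    intro a ha
    rw [mem_Icc] at ha
    exact ⟨Real.sqrt_le_sqrt (by exact_mod_cast ha.1), Real.sqrt_le_sqrt (by exact_mod_cast ha.2)⟩
  set D : ℕ → ℕ → ℂ := fun a b => ∑' n : ℤ, K ((n - √(a : ℝ) * √(b : ℝ) / d) / s) -
    s * (𝓕 K 0 + ∑ h ∈ Icc 1 G, (𝓕 K (s * h) * expChar (-(h * (√(a : ℝ) * √(b : ℝ) / d))) +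
      𝓕 K (-(s * h)) * expChar (h * (√(a : ℝ) * √(b : ℝ) / d)))) with hD
  have hDle : ∀ a b, ‖D a b‖ ≤ C / (s * T ^ J) := fun a b =>
    hPoisson s T _ hs0 (by linarith) G hsG
  set E₁ : ℕ → ℂ := fun b => ∑ j ∈ Icc 1 G ×ˢ A,
    𝓕 K (s * j.1) * expChar (j.1 * √(j.2 : ℝ) / d * (-1 * √(b : ℝ))) with hE₁
  set E₂ : ℕ → ℂ := fun b => ∑ j ∈ Icc 1 G ×ˢ A,
    𝓕 K (-(s * j.1)) * expChar (j.1 * √(j.2 : ℝ) / d * (1 * √(b : ℝ))) with hE₂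
  have hmain : ((∑ a ∈ A, ∑ b ∈ B, ∑ P ∈ Icc 1 (3 * N) with d ∣ P,
      k ((P - √(a : ℝ) * √(b : ℝ)) * V) - κ * (#A * #B) / (d * V) : ℝ) : ℂ) =
      ∑ a ∈ A, ∑ b ∈ B, D a b + s * (∑ b ∈ B, E₁ b + ∑ b ∈ B, E₂ b) := by
    have h1 : ∀ a ∈ A, ∀ b ∈ B, ((∑ P ∈ Icc 1 (3 * N) with d ∣ P,
        k ((P - √(a : ℝ) * √(b : ℝ)) * V) : ℝ) : ℂ) = D a b + s * κ +
          s * (∑ h ∈ Icc 1 G, 𝓕 K (s * h) * expChar (h * √(a : ℝ) / d * (-1 * √(b : ℝ))) +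
          ∑ h ∈ Icc 1 G, 𝓕 K (-(s * h)) * expChar (h * √(a : ℝ) / d * (1 * √(b : ℝ)))) := by
      intro a ha b hb
      have hxa := hx a (hA ha)
      have hxb := hx b (hB hb)
      have h2 := sum_multiples_eq_tsum K (fun x hx => by rw [hKk, hK x hx, Complex.ofReal_zero])
        (N := N) (d := d) (x := √(a : ℝ) * √(b : ℝ)) (V := V) ?_ ?_ hd hV
      · push_cast
        simp only [hKk] at h2
        rw [h2, hD]
        simp only [hKk]
        rw [hκ, ← sum_add_distrib]
        have e : ∀ h : ℕ, expChar (h * √(a : ℝ) / d * (-1 * √(b : ℝ))) =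
            expChar (-(h * (√(a : ℝ) * √(b : ℝ) / d))) := fun h => by congr 1; ring
        have e' : ∀ h : ℕ, expChar (h * √(a : ℝ) / d * (1 * √(b : ℝ))) =
            expChar (h * (√(a : ℝ) * √(b : ℝ) / d)) := fun h => by congr 1; ring
        simp only [e, e']
        ring
      · calc (N : ℝ) + 1 = √((N : ℝ) + 1) * √((N : ℝ) + 1) :=
            (Real.mul_self_sqrt (by positivity)).symm
          _ ≤ _ := mul_le_mul hxa.1 hxb.1 (Real.sqrt_nonneg _) (Real.sqrt_nonneg _)
      · calc _ ≤ √(2 * (N : ℝ)) * √(2 * (N : ℝ)) :=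
            mul_le_mul hxa.2 hxb.2 (Real.sqrt_nonneg _) (Real.sqrt_nonneg _)
          _ = 2 * N := Real.mul_self_sqrt (by positivity)
    have hE : ∀ f : ℕ → ℕ → ℕ → ℂ, ∑ a ∈ A, ∑ b ∈ B, ∑ h ∈ Icc 1 G, f h a b =
        ∑ b ∈ B, ∑ j ∈ Icc 1 G ×ˢ A, f j.1 j.2 b := by
      intro f
      rw [sum_comm]
      refine sum_congr rfl fun b _ => ?_
      rw [sum_product_right]
    rw [Complex.ofReal_sub, Complex.ofReal_sum]
    have h3 : ∀ a ∈ A, ((∑ b ∈ B, ∑ P ∈ Icc 1 (3 * N) with d ∣ P,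
        k ((P - √(a : ℝ) * √(b : ℝ)) * V) : ℝ) : ℂ) = _ := fun a ha =>
      (Complex.ofReal_sum _ _).trans (sum_congr rfl (h1 a ha))
    rw [sum_congr rfl h3]
    simp only [sum_add_distrib, ← mul_sum, hE, sum_const, nsmul_eq_mul]
    rw [hE₁, hE₂, hs]
    push_cast
    ring
  rw [← Real.norm_eq_abs, ← Complex.norm_real, hmain]
  have hcardA : (#A : ℝ) ≤ N := by
    have h := card_le_card hA
    rw [Nat.card_Icc] at h
    exact_mod_cast h.trans (by omega)
  have hcardB : (#B : ℝ) ≤ N := by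
    have h := card_le_card hB
    rw [Nat.card_Icc] at h
    exact_mod_cast h.trans (by omega)
  have hb1 : ‖∑ a ∈ A, ∑ b ∈ B, D a b‖ ≤ C * (√(#B : ℝ) * N * T ^ 3) := by
    have h1 : ‖∑ a ∈ A, ∑ b ∈ B, D a b‖ ≤ ∑ a ∈ A, ∑ b ∈ B, C / (s * T ^ J) :=
      (norm_sum_le _ _).trans (sum_le_sum fun a _ => (norm_sum_le _ _).trans
        (sum_le_sum fun b _ => hDle a b))
    simp only [sum_const, nsmul_eq_mul] at h1
    have h2 : C / (s * T ^ J) ≤ C * (√N / N) := by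
      rw [hs, div_eq_mul_inv, mul_inv, one_div, inv_inv]
      have h3 : d * V ≤ √N := Real.le_sqrt_of_sq_le hdV
      rw [div_eq_mul_inv]
      gcongr
    have h4 : (#B : ℝ) ≤ √(#B : ℝ) * √N := calc
      _ = √(#B : ℝ) * √(#B : ℝ) := (Real.mul_self_sqrt (by positivity)).symm
      _ ≤ _ := by gcongr
    have h6 : √(N : ℝ) * √N = N := Real.mul_self_sqrt (by positivity)
    calc _ ≤ _ := h1
      _ ≤ N * (√(#B : ℝ) * √N * (C * (√N / N))) := by
        gcongr
      _ = C * (√(#B : ℝ) * (√N * √N)) := by field_simp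
      _ = C * (√(#B : ℝ) * N * 1) := by rw [h6, mul_one]
      _ ≤ _ := by gcongr; exact one_le_pow₀ hT
  have hb2 : ∀ θ : ℝ, |θ| = 1 → ∀ c : ℕ → ℂ, (∀ h, ‖c h‖ ≤ M) → ‖∑ b ∈ B, ∑ j ∈ Icc 1 G ×ˢ A,
      c j.1 * expChar (j.1 * √(j.2 : ℝ) / d * (θ * √(b : ℝ)))‖ ≤
      M * Q * (√(#B : ℝ) * (d * N * V * T ^ 3)) := fun θ hθ c hc =>
    (norm_sum_le _ _).trans (sum_norm_exp_sum_le N G A B V T d θ M c hN hG0 hA hB hV hVN hT hd1 hdV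
      hGle hTexp hlogG hM hc hθ)
  have hb3 := hb2 (-1) (by simp) (fun h => 𝓕 K (s * h)) (fun h => hMK _)
  have hb4 := hb2 1 (by simp) (fun h => 𝓕 K (-(s * h))) (fun h => hMK _)
  have hsm : s * (M * Q * (√(#B : ℝ) * (d * N * V * T ^ 3))) = M * Q * (√(#B : ℝ) * N * T ^ 3) := by
    rw [hs]
    field_simp
  calc _ ≤ ‖∑ a ∈ A, ∑ b ∈ B, D a b‖ + s * (‖∑ b ∈ B, E₁ b‖ + ‖∑ b ∈ B, E₂ b‖) := by
        refine (norm_add_le _ _).trans ?_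
        rw [norm_mul, Complex.norm_real, Real.norm_of_nonneg hs0.le]
        gcongr
        exact norm_add_le _ _
    _ ≤ C * (√(#B : ℝ) * N * T ^ 3) + s * (M * Q * (√(#B : ℝ) * (d * N * V * T ^ 3)) +
        M * Q * (√(#B : ℝ) * (d * N * V * T ^ 3))) := by gcongr
    _ = _ := by
      rw [mul_add, hsm]
      ring

open Finset in
theorem pow_length_primeFactorsList_sub_two_le {P y : ℕ} (hP : P ≠ 0)
    (hsum : ∑ p ∈ y.primesLE, ∑ j ∈ Icc 1 (Nat.log p y), (if p ^ j ∣ P then 1 else 0) ≤ 2)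
    (hno : ∀ p ∈ y.primesLE, ¬ p ^ (Nat.log p y + 1) ∣ P) :
    y ^ (P.primeFactorsList.length - 2) ≤ P := by
  have h1 : ∀ p ∈ y.primesLE, ∑ j ∈ Icc 1 (Nat.log p y), (if p ^ j ∣ P then 1 else 0) =
      P.factorization p := by
    intro p hp
    have hpp := Nat.prime_of_mem_primesLE hp
    have h2 := hno p hp
    rw [hpp.pow_dvd_iff_le_factorization hP] at h2
    have h3 : {j ∈ Icc 1 (Nat.log p y) | p ^ j ∣ P} = Icc 1 (P.factorization p) := by
      ext j
      simp only [mem_filter, mem_Icc, hpp.pow_dvd_iff_le_factorization hP]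
      omega
    rw [← card_filter, h3, Nat.card_Icc, Nat.add_sub_cancel]
  rw [sum_congr rfl h1] at hsum
  have h4 : P.primeFactorsList.length = ∑ p ∈ P.primeFactors, P.factorization p :=
    ArithmeticFunction.cardFactors_eq_sum_factorization
  rw [← sum_filter_add_sum_filter_not _ (fun p => p ≤ y)] at h4
  have h5 : ∑ p ∈ P.primeFactors with p ≤ y, P.factorization p ≤ 2 := by
    refine le_trans (sum_le_sum_of_subset ?_) hsum
    intro p hp
    rw [mem_filter] at hp
    exact Nat.mem_primesLE.2 ⟨hp.2, Nat.prime_of_mem_primeFactors hp.1⟩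
  have h6 : y ^ ∑ p ∈ P.primeFactors with ¬ p ≤ y, P.factorization p ≤ P := by
    conv_rhs => rw [← Nat.prod_factorization_pow_eq_self hP]
    rw [← prod_pow_eq_pow_sum, Finsupp.prod, Nat.support_factorization]
    calc _ ≤ ∏ p ∈ P.primeFactors with ¬ p ≤ y, p ^ P.factorization p :=
          prod_le_prod' fun p hp => Nat.pow_le_pow_left (not_le.1 (mem_filter.1 hp).2).le _
      _ ≤ _ := prod_le_prod_of_subset_of_one_le' (filter_subset _ _) fun p hp _ =>
          Nat.one_le_pow _ _ (Nat.prime_of_mem_primeFactors hp).pos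
  rcases Nat.eq_zero_or_pos y with rfl | hy
  · rcases Nat.eq_zero_or_pos (P.primeFactorsList.length - 2) with h | h
    · rw [h, pow_zero]; omega
    · rw [zero_pow h.ne']; omega
  · exact (Nat.pow_le_pow_right hy (by omega)).trans h6

open Finset in
/-- The divisor sum of the sieve weights. -/
noncomputable def sieveSum (R P : ℕ) : ℝ := ∑ e ∈ Icc 1 R with e ∣ P, sieveWeight R e

open Finset in
theorem sum_mul_sieveSum_sq (R M q : ℕ) (w : ℕ → ℝ) :
    ∑ P ∈ Icc 1 M with q ∣ P, w P * sieveSum R P ^ 2 =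
      ∑ a ∈ Icc 1 R, ∑ b ∈ Icc 1 R, sieveWeight R a * sieveWeight R b *
        ∑ P ∈ Icc 1 M with (a.lcm b).lcm q ∣ P, w P := by
  have h1 : ∀ P, w P * sieveSum R P ^ 2 = ∑ a ∈ Icc 1 R, ∑ b ∈ Icc 1 R,
      sieveWeight R a * sieveWeight R b * (if a ∣ P ∧ b ∣ P then w P else 0) := by
    intro P
    rw [sieveSum, sq, sum_filter, sum_mul_sum, mul_sum]
    refine sum_congr rfl fun a _ => ?_
    rw [mul_sum]
    refine sum_congr rfl fun b _ => ?_
    by_cases ha : a ∣ P <;> by_cases hb : b ∣ P <;> simp [ha, hb]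
    ring
  simp only [h1]
  rw [sum_comm]
  refine sum_congr rfl fun a _ => ?_
  rw [sum_comm]
  refine sum_congr rfl fun b _ => ?_
  rw [← mul_sum, ← sum_filter, filter_filter]
  congr 2
  ext P
  simp only [mem_filter, Nat.lcm_dvd_iff]
  tauto

open Finset in
theorem abs_sum_mul_sieveSum_sq_sub_le {R M q : ℕ} {w : ℕ → ℝ} {X E L : ℝ} (hq : 0 < q)
    (hqR : q ≤ R ^ 2)
    (hL : ∀ e ∈ Icc 1 R, |sieveWeight R e| ≤ L)
    (hS : ∀ q ∈ Icc 1 (R ^ 4), |∑ P ∈ Icc 1 M with q ∣ P, w P - X / q| ≤ E) :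
    |∑ P ∈ Icc 1 M with q ∣ P, w P * sieveSum R P ^ 2 - X * sieveForm R q| ≤ R ^ 2 * L ^ 2 * E := by
  rw [sum_mul_sieveSum_sq, sieveForm, mul_sum, ← sum_sub_distrib]
  have h1 : ∀ a ∈ Icc 1 R, ∀ b ∈ Icc 1 R, |sieveWeight R a * sieveWeight R b *
      ∑ P ∈ Icc 1 M with (a.lcm b).lcm q ∣ P, w P -
      X * (sieveWeight R a * sieveWeight R b * (((a.lcm b).lcm q : ℕ) : ℝ)⁻¹)| ≤ L ^ 2 * E := by
    intro a ha b hb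
    have hLa := hL a ha
    have hLb := hL b hb
    rw [mem_Icc] at ha hb
    have h2 := hS ((a.lcm b).lcm q) (mem_Icc.2 ⟨?_, ?_⟩)
    · rw [show ∀ x y s l : ℝ, x * y * s - X * (x * y * l⁻¹) = x * y * (s - X / l) from
        fun x y s l => by ring, abs_mul, abs_mul, sq]
      have hL0 : 0 ≤ L := (abs_nonneg _).trans hLa
      gcongr
    · exact Nat.lcm_pos (Nat.lcm_pos ha.1 hb.1) hq
    · calc _ ≤ (a.lcm b) * q := Nat.le_of_dvd (by have := Nat.lcm_pos ha.1 hb.1; positivity)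
            (Nat.lcm_dvd_mul _ _)
        _ ≤ (a * b) * q := by
          gcongr
          exact Nat.le_of_dvd (by nlinarith) (Nat.lcm_dvd_mul _ _)
        _ ≤ (R * R) * R ^ 2 := by
          gcongr
          · exact ha.2
          · exact hb.2
        _ = R ^ 4 := by ring
  calc _ ≤ ∑ a ∈ Icc 1 R, ∑ b ∈ Icc 1 R, L ^ 2 * E := by
        refine (abs_sum_le_sum_abs _ _).trans (sum_le_sum fun a ha => ?_)
        rw [mul_sum, ← sum_sub_distrib]
        exact (abs_sum_le_sum_abs _ _).trans (sum_le_sum fun b hb => h1 a ha b hb)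
    _ = _ := by
        simp only [sum_const, Nat.card_Icc, nsmul_eq_mul, Nat.add_sub_cancel]
        ring

open Finset in
theorem sum_primesLE_inv_pow_succ_log_le {R : ℕ} (hR : 0 < R) :
    ∑ p ∈ (R ^ 2).primesLE, ((p ^ (Nat.log p (R ^ 2) + 1) : ℕ) : ℝ)⁻¹ ≤
      (1 + Real.log (R ^ 2)) / R := by
  have hR0 : (0 : ℝ) < R := by exact_mod_cast hR
  have h1 : ∀ p ∈ (R ^ 2).primesLE, ((p ^ (Nat.log p (R ^ 2) + 1) : ℕ) : ℝ)⁻¹ ≤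
      (p : ℝ)⁻¹ * (R : ℝ)⁻¹ := by
    intro p hp
    have hpp := Nat.prime_of_mem_primesLE hp
    have hp0 : (0 : ℝ) < p := by exact_mod_cast hpp.pos
    rw [← mul_inv]
    apply inv_anti₀ (by positivity)
    have h2 : R ^ 2 < p ^ (Nat.log p (R ^ 2) + 1) := Nat.lt_pow_succ_log_self hpp.one_lt _
    have h3 : p ^ 2 ≤ p ^ (Nat.log p (R ^ 2) + 1) := by
      apply Nat.pow_le_pow_right hpp.pos
      have := Nat.log_pos hpp.one_lt (Nat.le_of_mem_primesLE hp)
      omega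
    have h4 : p * R ≤ p ^ (Nat.log p (R ^ 2) + 1) := by
      rcases le_total p R with h | h
      · nlinarith
      · nlinarith
    exact_mod_cast h4
  calc _ ≤ ∑ p ∈ (R ^ 2).primesLE, (p : ℝ)⁻¹ * (R : ℝ)⁻¹ := sum_le_sum h1
    _ ≤ ∑ p ∈ Icc 1 (R ^ 2), (p : ℝ)⁻¹ * (R : ℝ)⁻¹ := by
      refine sum_le_sum_of_subset_of_nonneg (fun p hp => ?_) fun _ _ _ => by positivity
      exact mem_Icc.2 ⟨(Nat.prime_of_mem_primesLE hp).pos, Nat.le_of_mem_primesLE hp⟩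
    _ ≤ _ := by
      rw [← sum_mul, div_eq_mul_inv]
      gcongr
      exact_mod_cast sum_Icc_inv_le (R ^ 2)

open Finset in
theorem abs_sieveSum_le {R P : ℕ} {L D : ℝ} (hP : P ≠ 0) (hL0 : 0 ≤ L)
    (hL : ∀ e ∈ Icc 1 R, |sieveWeight R e| ≤ L) (hD : (#P.divisors : ℝ) ≤ D) :
    |sieveSum R P| ≤ L * D := by
  calc |sieveSum R P| ≤ ∑ e ∈ Icc 1 R with e ∣ P, |sieveWeight R e| := abs_sum_le_sum_abs _ _
    _ ≤ ∑ e ∈ Icc 1 R with e ∣ P, L := sum_le_sum fun e he => hL e (mem_filter.1 he).1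
    _ = #{e ∈ Icc 1 R | e ∣ P} * L := by rw [sum_const, nsmul_eq_mul]
    _ ≤ #P.divisors * L := by
      gcongr
      intro e he
      exact Nat.mem_divisors.2 ⟨(mem_filter.1 he).2, hP⟩
    _ ≤ D * L := by gcongr
    _ = _ := mul_comm _ _

open Finset in
theorem exists_pow_length_le {R M : ℕ} {w : ℕ → ℝ} {X E L D : ℝ} (hR : 1 < R) (hw : ∀ P, 0 ≤ w P)
    (hX : 0 ≤ X) (hE : 0 ≤ E) (hL0 : 0 ≤ L) (hL : ∀ e ∈ Icc 1 R, |sieveWeight R e| ≤ L)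
    (hD : ∀ P ∈ Icc 1 M, (#P.divisors : ℝ) ≤ D)
    (hS : ∀ q ∈ Icc 1 (R ^ 4), |∑ P ∈ Icc 1 M with q ∣ P, w P - X / q| ≤ E)
    (hform : 1 ≤ 3 * sieveForm R 1 -
      ∑ p ∈ (R ^ 2).primesLE, ∑ j ∈ Icc 1 (Nat.log p (R ^ 2)), sieveForm R (p ^ j))
    (hlarge : (3 + R ^ 2 * Nat.log 2 (R ^ 2)) * (R ^ 2 * L ^ 2 * E) +
      3 * (L * D) ^ 2 * (X * ((1 + Real.log (R ^ 2)) / R) + R ^ 2 * E) < X) :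
    ∃ P ∈ Icc 1 M, w P ≠ 0 ∧ (R ^ 2) ^ (P.primeFactorsList.length - 2) ≤ P := by
  by_contra! hcon
  set W : ℕ → ℝ := fun P => w P * sieveSum R P ^ 2 with hW
  have hW0 : ∀ P, 0 ≤ W P := fun P => mul_nonneg (hw P) (sq_nonneg _)
  set y := R ^ 2 with hy
  have hbad : ∀ P ∈ Icc 1 M, W P * (3 - ∑ p ∈ y.primesLE, ∑ j ∈ Icc 1 (Nat.log p y),
      (if p ^ j ∣ P then (1 : ℝ) else 0)) ≤
      3 * ∑ p ∈ y.primesLE, (if p ^ (Nat.log p y + 1) ∣ P then W P else 0) := by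
    intro P hP
    have hP0 : P ≠ 0 := by have := (mem_Icc.1 hP).1; omega
    have hs0 : (0 : ℝ) ≤ ∑ p ∈ y.primesLE, ∑ j ∈ Icc 1 (Nat.log p y),
        (if p ^ j ∣ P then (1 : ℝ) else 0) := by positivity
    have ht0 : ∀ p ∈ y.primesLE, (0 : ℝ) ≤ if p ^ (Nat.log p y + 1) ∣ P then W P else 0 :=
      fun p _ => by split_ifs <;> simp [hW0]
    by_cases h1 : ∃ p ∈ y.primesLE, p ^ (Nat.log p y + 1) ∣ P
    · obtain ⟨p, hp, hdvd⟩ := h1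
      have h2 := single_le_sum ht0 hp
      rw [if_pos hdvd] at h2
      nlinarith [hW0 P]
    · push Not at h1
      by_cases h3 : w P = 0
      · simp [hW, h3]
      · have h4 := hcon P hP h3
        have h5 : ¬ ∑ p ∈ y.primesLE, ∑ j ∈ Icc 1 (Nat.log p y), (if p ^ j ∣ P then 1 else 0) ≤ 2 :=
          fun h5 => absurd (pow_length_primeFactorsList_sub_two_le hP0 h5 h1) (not_le.2 h4)
        have h6 : (3 : ℝ) ≤ ∑ p ∈ y.primesLE, ∑ j ∈ Icc 1 (Nat.log p y),
            (if p ^ j ∣ P then (1 : ℝ) else 0) := by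
          have : 3 ≤ ∑ p ∈ y.primesLE, ∑ j ∈ Icc 1 (Nat.log p y), (if p ^ j ∣ P then 1 else 0) := by
            omega
          exact_mod_cast this
        have h7 := sum_nonneg ht0
        nlinarith [hW0 P]
  have hsum := sum_le_sum hbad
  have hl : ∑ P ∈ Icc 1 M, W P * (3 - ∑ p ∈ y.primesLE, ∑ j ∈ Icc 1 (Nat.log p y),
      (if p ^ j ∣ P then (1 : ℝ) else 0)) = 3 * ∑ P ∈ Icc 1 M with 1 ∣ P, W P -
      ∑ p ∈ y.primesLE, ∑ j ∈ Icc 1 (Nat.log p y), ∑ P ∈ Icc 1 M with p ^ j ∣ P, W P := by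
    simp only [mul_sub, sum_sub_distrib, mul_sum, mul_ite, mul_one, mul_zero, one_dvd, filter_true]
    congr 1
    · exact sum_congr rfl fun _ _ => mul_comm _ _
    · rw [sum_comm]
      refine sum_congr rfl fun p _ => ?_
      rw [sum_comm]
      exact sum_congr rfl fun j _ => (sum_filter _ _).symm
  have hr : ∑ P ∈ Icc 1 M, 3 * ∑ p ∈ y.primesLE, (if p ^ (Nat.log p y + 1) ∣ P then W P else 0) =
      3 * ∑ p ∈ y.primesLE, ∑ P ∈ Icc 1 M with p ^ (Nat.log p y + 1) ∣ P, W P := by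
    rw [← mul_sum, sum_comm]
    congr 1
    exact sum_congr rfl fun j _ => (sum_filter _ _).symm
  rw [hl, hr] at hsum
  have hcardy : (#y.primesLE : ℝ) ≤ y := by
    have : y.primesLE ⊆ Icc 1 y := fun p hp =>
      mem_Icc.2 ⟨(Nat.prime_of_mem_primesLE hp).pos, Nat.le_of_mem_primesLE hp⟩
    have := card_le_card this
    rw [Nat.card_Icc, Nat.add_sub_cancel] at this
    exact_mod_cast this
  set F := R ^ 2 * L ^ 2 * E with hF
  have hF0 : 0 ≤ F := by positivity
  have hm1 : X * sieveForm R 1 - F ≤ ∑ P ∈ Icc 1 M with 1 ∣ P, W P := by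
    have := abs_sum_mul_sieveSum_sq_sub_le (q := 1) one_pos (Nat.one_le_pow _ _ (by omega)) hL hS
    linarith [(abs_le.1 this).1]
  have hm2 : ∑ p ∈ y.primesLE, ∑ j ∈ Icc 1 (Nat.log p y), ∑ P ∈ Icc 1 M with p ^ j ∣ P, W P ≤
      X * ∑ p ∈ y.primesLE, ∑ j ∈ Icc 1 (Nat.log p y), sieveForm R (p ^ j) +
        y * Nat.log 2 y * F := by
    have h1 : ∀ p ∈ y.primesLE, ∀ j ∈ Icc 1 (Nat.log p y), ∑ P ∈ Icc 1 M with p ^ j ∣ P, W P ≤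
        X * sieveForm R (p ^ j) + F := by
      intro p hp j hj
      have hpp := Nat.prime_of_mem_primesLE hp
      have := abs_sum_mul_sieveSum_sq_sub_le (q := p ^ j) (pow_pos hpp.pos _)
        (Nat.pow_le_of_le_log (by positivity) (mem_Icc.1 hj).2) hL hS
      linarith [(abs_le.1 this).2]
    calc _ ≤ ∑ p ∈ y.primesLE, ∑ j ∈ Icc 1 (Nat.log p y), (X * sieveForm R (p ^ j) + F) :=
        sum_le_sum fun p hp => sum_le_sum fun j hj => h1 p hp j hj
      _ = X * ∑ p ∈ y.primesLE, ∑ j ∈ Icc 1 (Nat.log p y), sieveForm R (p ^ j) +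
        ∑ p ∈ y.primesLE, (Nat.log p y : ℝ) * F := by
        simp only [sum_add_distrib, mul_sum, sum_const, Nat.card_Icc, Nat.add_sub_cancel,
          nsmul_eq_mul]
      _ ≤ X * ∑ p ∈ y.primesLE, ∑ j ∈ Icc 1 (Nat.log p y), sieveForm R (p ^ j) +
        ∑ p ∈ y.primesLE, (Nat.log 2 y : ℝ) * F := by
        gcongr with p hp
        · norm_num
        · exact (Nat.prime_of_mem_primesLE hp).two_le
      _ ≤ _ := by
        rw [sum_const, nsmul_eq_mul, mul_assoc (y : ℝ)]
        gcongr
  have hm3 : ∑ p ∈ y.primesLE, ∑ P ∈ Icc 1 M with p ^ (Nat.log p y + 1) ∣ P, W P ≤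
      (L * D) ^ 2 * (X * ((1 + Real.log y) / R) + y * E) := by
    have h1 : ∀ p ∈ y.primesLE, ∑ P ∈ Icc 1 M with p ^ (Nat.log p y + 1) ∣ P, W P ≤
        (L * D) ^ 2 * (X * ((p ^ (Nat.log p y + 1) : ℕ) : ℝ)⁻¹ + E) := by
      intro p hp
      have hpp := Nat.prime_of_mem_primesLE hp
      have h2 := hS (p ^ (Nat.log p y + 1)) (mem_Icc.2 ⟨pow_pos hpp.pos _, ?_⟩)
      · calc _ ≤ ∑ P ∈ Icc 1 M with p ^ (Nat.log p y + 1) ∣ P, (L * D) ^ 2 * w P := by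
              refine sum_le_sum fun P hP => ?_
              have hP' := (mem_filter.1 hP).1
              have hP0 : P ≠ 0 := by have := (mem_Icc.1 hP').1; omega
              have := abs_sieveSum_le hP0 hL0 hL (hD P hP')
              have h3 : sieveSum R P ^ 2 ≤ (L * D) ^ 2 := by
                rw [← sq_abs]
                exact pow_le_pow_left₀ (abs_nonneg _) this 2
              exact (mul_comm _ _).trans_le (mul_le_mul_of_nonneg_right h3 (hw P))
          _ ≤ _ := by
            rw [← mul_sum]
            gcongr
            rw [← div_eq_mul_inv]
            linarith [(abs_le.1 h2).2]
      · calc p ^ (Nat.log p y + 1) = p ^ Nat.log p y * p := pow_succ _ _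
          _ ≤ y * y := Nat.mul_le_mul (Nat.pow_log_le_self _ (by positivity))
              (Nat.le_of_mem_primesLE hp)
          _ = R ^ 4 := by rw [hy]; ring
    refine (sum_le_sum h1).trans ?_
    rw [← mul_sum, sum_add_distrib, ← mul_sum, sum_const, nsmul_eq_mul]
    have h2 := sum_primesLE_inv_pow_succ_log_le (show 0 < R by omega)
    gcongr
    rw [hy]
    push_cast
    exact_mod_cast h2
  have hX2 : X * 1 ≤ X * (3 * sieveForm R 1 -
      ∑ p ∈ y.primesLE, ∑ j ∈ Icc 1 (Nat.log p y), sieveForm R (p ^ j)) :=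
    mul_le_mul_of_nonneg_left hform hX
  have hyR : (y : ℝ) = (R : ℝ) ^ 2 := by rw [hy]; push_cast; rfl
  rw [hyR] at hm2 hm3
  linarith

theorem eventually_const_mul_rpow_le (C : ℝ) {a b : ℝ} (hab : a < b) :
    ∀ᶠ N : ℕ in Filter.atTop, C * (N : ℝ) ^ a ≤ (N : ℝ) ^ b := by
  have h1 : Filter.Tendsto (fun N : ℕ => (N : ℝ) ^ (b - a)) Filter.atTop Filter.atTop :=
    (tendsto_rpow_atTop (sub_pos.2 hab)).comp tendsto_natCast_atTop_atTop
  filter_upwards [h1.eventually_ge_atTop C, Filter.eventually_gt_atTop 0] with N hN hN0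
  have hN0' : (0 : ℝ) < N := by exact_mod_cast hN0
  calc C * (N : ℝ) ^ a ≤ (N : ℝ) ^ (b - a) * (N : ℝ) ^ a := by gcongr
    _ = _ := by rw [← Real.rpow_add hN0', sub_add_cancel]

theorem eventually_one_add_log_le_rpow (C : ℝ) {ε : ℝ} (hε : 0 < ε) :
    ∀ᶠ N : ℕ in Filter.atTop, 1 + C * Real.log N ≤ (N : ℝ) ^ ε := by
  have h1 := ((isLittleO_log_rpow_atTop hε).const_mul_left C).add
    ((Real.isLittleO_const_log_atTop (c := (1 : ℝ))).trans (isLittleO_log_rpow_atTop hε))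
  have h2 := (h1.comp_tendsto tendsto_natCast_atTop_atTop).bound one_pos
  filter_upwards [h2] with N hN
  simp only [Function.comp_apply, one_mul] at hN
  rw [Real.norm_of_nonneg (by positivity : (0 : ℝ) ≤ (N : ℝ) ^ ε)] at hN
  linarith [le_abs_self (C * Real.log N + 1), Real.norm_eq_abs (C * Real.log N + 1)]

theorem sieve_error_lt {R ℓ T C C₁ C₂ g n X lg : ℝ} (hR : 1 ≤ R) (hℓ : ℓ ≤ T) (hT : 1 ≤ T)
    (hlg : lg ≤ T) (hC : 0 < C) (hg : 0 < g) (hn : 0 ≤ n) (hX : 0 < X)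
    (hgR : g ≤ R) (hRg : R ≤ 2 * g)
    (h1 : 16 * (4 * C₁ ^ 2 + 27 * (C₁ * C₂) ^ 2) * C * (g ^ 4 * T ^ 7) * n ≤ X / 4)
    (h2 : 27 * (C₁ * C₂) ^ 2 * T ^ 5 ≤ g / 4) :
    (3 + R ^ 2 * ℓ) * (R ^ 2 * (C₁ * T) ^ 2 * (C * (n * T ^ 3))) +
      3 * (C₁ * T * (3 * C₂ * T)) ^ 2 * (X * (lg / R) + R ^ 2 * (C * (n * T ^ 3))) < X := by
  have hR0 : 0 < R := by linarith
  have hT0 : 0 < T := by linarith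
  have hR2 : 1 ≤ R ^ 2 := one_le_pow₀ hR
  have hR4 : R ^ 4 ≤ 16 * g ^ 4 := by
    calc R ^ 4 ≤ (2 * g) ^ 4 := by gcongr
      _ = _ := by ring
  have a1 : 3 + R ^ 2 * ℓ ≤ 4 * (R ^ 2 * T) := by
    have : R ^ 2 * ℓ ≤ R ^ 2 * T := by gcongr
    nlinarith
  have e1 : (3 + R ^ 2 * ℓ) * (R ^ 2 * (C₁ * T) ^ 2 * (C * (n * T ^ 3))) ≤
      4 * C₁ ^ 2 * (R ^ 4 * (C * n) * T ^ 7) := by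
    calc _ ≤ 4 * (R ^ 2 * T) * (R ^ 2 * (C₁ * T) ^ 2 * (C * (n * T ^ 3))) := by gcongr
      _ = 4 * C₁ ^ 2 * (R ^ 4 * (C * n) * T ^ 6) := by ring
      _ ≤ _ := by
        gcongr
        norm_num
  have e2 : 3 * (C₁ * T * (3 * C₂ * T)) ^ 2 * (R ^ 2 * (C * (n * T ^ 3))) ≤
      27 * (C₁ * C₂) ^ 2 * (R ^ 4 * (C * n) * T ^ 7) := by
    calc _ = 27 * (C₁ * C₂) ^ 2 * (R ^ 2 * (C * n) * T ^ 7) := by ring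
      _ ≤ _ := by
        gcongr
        · norm_num
  have e3 : 3 * (C₁ * T * (3 * C₂ * T)) ^ 2 * (X * (lg / R)) ≤ X / 4 := by
    calc _ ≤ 3 * (C₁ * T * (3 * C₂ * T)) ^ 2 * (X * (T / g)) := by gcongr
      _ = 27 * (C₁ * C₂) ^ 2 * T ^ 5 * (X / g) := by ring
      _ ≤ g / 4 * (X / g) := by gcongr
      _ = _ := by field_simp
  have e4 : (4 * C₁ ^ 2 + 27 * (C₁ * C₂) ^ 2) * (R ^ 4 * (C * n) * T ^ 7) ≤ X / 4 := by
    refine le_trans ?_ h1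
    calc _ ≤ (4 * C₁ ^ 2 + 27 * (C₁ * C₂) ^ 2) * (16 * g ^ 4 * (C * n) * T ^ 7) := by gcongr
      _ = _ := by ring
  rw [mul_add (3 * (C₁ * T * (3 * C₂ * T)) ^ 2)]
  linarith

theorem abs_mul_sub_sq_le_of_abs_sub_mul_lt_one {N a b P : ℕ} {δ : ℝ} (hN : (1 : ℝ) ≤ N)
    (hδ : 0 ≤ δ) (hδ1 : δ ≤ 1) (ha : N + 1 ≤ a ∧ a ≤ 2 * N) (hb : N + 1 ≤ b ∧ b ≤ 2 * N)
    (h : |(P : ℝ) - √(a : ℝ) * √(b : ℝ)| * (N : ℝ) ^ δ < 1) :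
    |(a * b : ℝ) - (P : ℝ) ^ 2| ≤ 5 * (P : ℝ) ^ (1 - δ) := by
  have hN0 : (0 : ℝ) < N := by linarith
  have hV1 : 1 ≤ (N : ℝ) ^ δ := Real.one_le_rpow hN hδ
  set V := (N : ℝ) ^ δ with hV
  have hV0 : 0 < V := by linarith
  set x := √(a : ℝ) * √(b : ℝ) with hx
  have ha1 : (N : ℝ) + 1 ≤ a := by exact_mod_cast ha.1
  have hb1 : (N : ℝ) + 1 ≤ b := by exact_mod_cast hb.1
  have ha2 : (a : ℝ) ≤ 2 * N := by exact_mod_cast ha.2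
  have hb2 : (b : ℝ) ≤ 2 * N := by exact_mod_cast hb.2
  have hxx : x ^ 2 = a * b := by
    rw [hx, mul_pow, Real.sq_sqrt (by positivity), Real.sq_sqrt (by positivity)]
  have hx0 : 0 ≤ x := by positivity
  have hx1 : (N : ℝ) + 1 ≤ x := by
    refine le_of_sq_le_sq ?_ hx0
    rw [hxx, sq]
    gcongr
  have hx2 : x ≤ 2 * N := by
    refine le_of_sq_le_sq ?_ (by positivity)
    rw [hxx, sq]
    gcongr
  have h2 : |(P : ℝ) - x| < 1 := (le_mul_of_one_le_right (abs_nonneg _) hV1).trans_lt h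
  have hPN : (N : ℝ) ≤ P := by linarith [(abs_lt.1 h2).1]
  have h3 : |(P : ℝ) - x| ≤ 1 / V := by rw [le_div_iff₀ hV0]; exact h.le
  rw [← hxx, abs_sub_comm, show (P : ℝ) ^ 2 - x ^ 2 = (P - x) * (P + x) by ring, abs_mul,
    abs_of_nonneg (show 0 ≤ (P : ℝ) + x by positivity)]
  calc _ ≤ 1 / V * (5 * N) := by
        gcongr
        linarith [(abs_lt.1 h2).2]
    _ = 5 * (N : ℝ) ^ (1 - δ) := by
      rw [Real.rpow_sub hN0, Real.rpow_one, hV]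
      ring
    _ ≤ _ := by
      gcongr

set_option maxHeartbeats 800000 in
open Finset in
open scoped SchwartzMap FourierTransform in
theorem exists_near_square_of_le {η β δ : ℝ} (hη : η ≤ 1) (hβ0 : 0 < β) (hβη : β ≤ η) (hδ : 0 < δ)
    {τ : ℝ} (hτ : τ = 3 / 4 * (η + β) - 1 - δ) (hτ0 : 0 < τ) {c : ℝ} (hc : 0 < c) :
    ∀ᶠ N : ℕ in Filter.atTop, ∀ A B : Finset ℕ, A ⊆ Icc (N + 1) (2 * N) → B ⊆ Icc (N + 1) (2 * N) →
      c * (N : ℝ) ^ η ≤ #A → c * (N : ℝ) ^ β ≤ #B → ∃ a ∈ A, ∃ b ∈ B, ∃ P : ℕ, 0 < P ∧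
        P.primeFactorsList.length ≤ ⌊3 / τ⌋₊ ∧
        |(a * b : ℝ) - (P : ℝ) ^ 2| ≤ 5 * (P : ℝ) ^ (1 - δ) := by
  have hτδ : τ + δ ≤ 1 / 2 := by linarith
  have hτ2 : τ < 1 / 2 := by linarith
  set ρ := τ / (5 - 2 * τ) with hρ
  have hρ0 : 0 < ρ := div_pos hτ0 (by linarith)
  have hρe : ρ * (5 - 2 * τ) = τ := div_mul_cancel₀ _ (by linarith)
  set ε := ρ * (1 - 2 * τ) / 8 with hε
  have hε0 : 0 < ε := by
    have : 0 < ρ * (1 - 2 * τ) := mul_pos hρ0 (by linarith)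
    positivity
  have h4ρ : 4 * ρ + 8 * ε = τ := by rw [hε]; linarith
  have hερ : 8 * ε < ρ := by rw [hε]; nlinarith
  have hσ : 1 < 2 * ρ * (3 / τ - 2) := by
    have : 2 * ρ * (3 / τ - 2) = (6 - 4 * τ) / (5 - 2 * τ) := by
      rw [hρ]
      have : 5 - 2 * τ ≠ 0 := by linarith
      field_simp
      ring
    rw [this, lt_div_iff₀ (by linarith)]
    linarith
  obtain ⟨K, k, κ, hKk, hk0, hk1, hκ0, hκ⟩ := exists_bump
  obtain ⟨C, hC, hdisc⟩ := exists_discrepancy_le K k κ hKk hk1 hκ ⌈1 / ε⌉₊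
  obtain ⟨C₁, hC₁, hweight⟩ := exists_abs_sieveWeight_le ε hε0
  obtain ⟨C₂, hC₂, hdiv⟩ := exists_card_divisors_le_rpow ε hε0
  have hgtend : Filter.Tendsto (fun N : ℕ => (N : ℝ) ^ ρ) Filter.atTop Filter.atTop :=
    (tendsto_rpow_atTop hρ0).comp tendsto_natCast_atTop_atTop
  have hRtend : Filter.Tendsto (fun N : ℕ => ⌈(N : ℝ) ^ ρ⌉₊) Filter.atTop Filter.atTop :=
    tendsto_nat_ceil_atTop.comp hgtend
  set Q := 16 * (4 * C₁ ^ 2 + 27 * (C₁ * C₂) ^ 2) * C with hQ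
  filter_upwards [Filter.eventually_ge_atTop 4, hRtend.eventually eventually_one_le_sieve,
    hRtend.eventually_gt_atTop 1, eventually_const_mul_rpow_le 256
        (show 8 * ρ + 2 * δ < 1 by linarith),
    eventually_one_add_log_le_rpow 4 hε0,
    eventually_const_mul_rpow_le (4 * Q / (κ * c * √c)) (show 4 * ρ + 7 * ε < τ by linarith),
    eventually_const_mul_rpow_le (4 * (27 * (C₁ * C₂) ^ 2)) (show 5 * ε < ρ by linarith),
    eventually_const_mul_rpow_le 4 hσ]
    with N hN hform hR1 hE1 hlogT hE4 hE5 hE6 A B hA hB hcA hcB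
  have hN4 : (4 : ℝ) ≤ N := by exact_mod_cast hN
  have hN1 : (1 : ℝ) ≤ N := by linarith
  have hN0 : (0 : ℝ) < N := by linarith
  set R := ⌈(N : ℝ) ^ ρ⌉₊ with hR
  set g := (N : ℝ) ^ ρ with hg
  set T := (N : ℝ) ^ ε with hT
  set V := (N : ℝ) ^ δ with hV
  have hg1 : 1 ≤ g := Real.one_le_rpow hN1 hρ0.le
  have hT1 : 1 ≤ T := Real.one_le_rpow hN1 hε0.le
  have hV1 : 1 ≤ V := Real.one_le_rpow hN1 hδ.le
  have hgR : g ≤ R := Nat.le_ceil _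
  have hRg : (R : ℝ) ≤ 2 * g := by
    have := Nat.ceil_lt_add_one (show 0 ≤ g by positivity)
    linarith
  have hR1' : (1 : ℝ) ≤ R := by exact_mod_cast hR1.le
  have hpow : ∀ (x : ℝ) (m : ℕ), ((N : ℝ) ^ x) ^ m = (N : ℝ) ^ (m * x) := fun x m => by
    rw [← Real.rpow_natCast, ← Real.rpow_mul hN0.le, mul_comm]
  have hRV : ((R : ℝ) ^ 4 * V) ^ 2 ≤ N := by
    calc ((R : ℝ) ^ 4 * V) ^ 2 ≤ ((2 * g) ^ 4 * V) ^ 2 := by gcongr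
      _ = 256 * (g ^ 8 * V ^ 2) := by ring
      _ = 256 * (N : ℝ) ^ (8 * ρ + 2 * δ) := by
        rw [hg, hV, hpow, hpow, ← Real.rpow_add hN0]
        norm_num
      _ ≤ (N : ℝ) ^ (1 : ℝ) := hE1
      _ = N := Real.rpow_one _
  have hR4V : (R : ℝ) ^ 4 * V ≤ N := by
    have : 1 ≤ (R : ℝ) ^ 4 * V := one_le_mul_of_one_le_of_one_le (one_le_pow₀ hR1') hV1
    exact (le_self_pow₀ this two_ne_zero).trans hRV
  have hR4 : (R : ℝ) ^ 4 ≤ N := le_trans (le_mul_of_one_le_right (by positivity) hV1) hR4V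
  have hR2 : (R : ℝ) ^ 2 ≤ N := (pow_le_pow_right₀ hR1' (by norm_num)).trans hR4
  have hRN : (R : ℝ) ≤ N := (le_self_pow₀ hR1' (by norm_num)).trans hR4
  have hlogN : 0 ≤ Real.log N := Real.log_nonneg hN1
  have hTN : T ≤ N := by
    calc T ≤ (N : ℝ) ^ (1 : ℝ) := Real.rpow_le_rpow_of_exponent_le hN1 (by linarith)
      _ = N := Real.rpow_one _
  have hexp : Real.exp (-T ^ 2) * (N : ℝ) ^ 2 ≤ 1 := by
    rw [← Real.exp_log hN0, ← Real.exp_nat_mul, ← Real.exp_add, Real.exp_le_one_iff]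
    push_cast
    linarith [le_self_pow₀ hT1 two_ne_zero]
  have hTJ : (N : ℝ) ≤ T ^ ⌈1 / ε⌉₊ := by
    rw [hT, hpow]
    nth_rw 1 [← Real.rpow_one (N : ℝ)]
    apply Real.rpow_le_rpow_of_exponent_le hN1
    have := Nat.le_ceil (1 / ε)
    rw [div_le_iff₀ hε0] at this
    exact this
  have hA0 : (0 : ℝ) < #A := lt_of_lt_of_le (by positivity) hcA
  have hB0 : (0 : ℝ) < #B := lt_of_lt_of_le (by positivity) hcB
  set w : ℕ → ℝ := fun P => ∑ a ∈ A, ∑ b ∈ B, k ((P - √(a : ℝ) * √(b : ℝ)) * V) with hw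
  set X := κ * (#A * #B) / V with hX
  have hX0 : 0 < X := by positivity
  have hS : ∀ q ∈ Icc 1 (R ^ 4), |∑ P ∈ Icc 1 (3 * N) with q ∣ P, w P - X / q| ≤
      C * (√(#B : ℝ) * N * T ^ 3) := by
    intro q hq
    rw [mem_Icc] at hq
    have hq1 : (1 : ℝ) ≤ q := by exact_mod_cast hq.1
    have hqR : (q : ℝ) ≤ (R : ℝ) ^ 4 := by exact_mod_cast hq.2
    have h1 := hdisc N q A B V T hN hA hB hV1 hT1 hq.1 (le_trans (by gcongr) hRV) hexp ?_ hTJ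
    · convert h1 using 2
      congr 1
      · rw [hw, sum_comm]
        refine sum_congr rfl fun a _ => ?_
        rw [sum_comm]
      · rw [hX]
        field_simp
    · have h2 : (q : ℝ) * V * T ≤ N * N := by
        gcongr
        exact le_trans (by gcongr) hR4V
      have h3 := Real.log_le_log (by positivity) h2
      rw [Real.log_mul hN0.ne' hN0.ne'] at h3
      linarith
  have hXlow : κ * c * √c * (√(#B : ℝ) * N * (N : ℝ) ^ τ) ≤ X := by
    have h1 : √c * (N : ℝ) ^ (β / 2) ≤ √(#B : ℝ) := by
      apply Real.le_sqrt_of_sq_le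
      rw [mul_pow, Real.sq_sqrt hc.le, hpow]
      convert hcB using 3
      push_cast
      ring
    have h2 : (N : ℝ) * (N : ℝ) ^ τ * V ≤ (N : ℝ) ^ η * (N : ℝ) ^ (β / 2) := by
      rw [hV, ← Real.rpow_add hN0]
      nth_rw 1 [← Real.rpow_one (N : ℝ)]
      rw [← Real.rpow_add hN0, ← Real.rpow_add hN0]
      apply Real.rpow_le_rpow_of_exponent_le hN1
      linarith
    rw [hX, le_div_iff₀ (by positivity)]
    calc _ = κ * c * √c * √(#B : ℝ) * ((N : ℝ) * (N : ℝ) ^ τ * V) := by ring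
      _ ≤ κ * c * √c * √(#B : ℝ) * ((N : ℝ) ^ η * (N : ℝ) ^ (β / 2)) := by gcongr
      _ = κ * ((c * (N : ℝ) ^ η) * (√(#B : ℝ) * (√c * (N : ℝ) ^ (β / 2)))) := by ring
      _ ≤ κ * (#A * (√(#B : ℝ) * √(#B : ℝ))) := by gcongr
      _ = _ := by rw [Real.mul_self_sqrt hB0.le]
  have hlarge := sieve_error_lt (R := R) (ℓ := Nat.log 2 (R ^ 2)) (T := T) (C := C) (C₁ := C₁)
      (C₂ := C₂)
    (g := g) (n := √(#B : ℝ) * N) (X := X) (lg := 1 + Real.log (R ^ 2)) hR1' ?_ hT1 ?_ hC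
    (by positivity) (by positivity) hX0 hgR hRg ?_ ?_
  rotate_left
  · have h1 := Real.natLog_le_logb (R ^ 2) 2
    rw [Real.logb, le_div_iff₀ (Real.log_pos (by norm_num))] at h1
    have h2 : Real.log ((R ^ 2 : ℕ) : ℝ) ≤ Real.log N := by
      push_cast
      exact Real.log_le_log (by positivity) hR2
    have h3 := Real.log_two_gt_d9
    push_cast at h1 h2
    have h4 : (Nat.log 2 (R ^ 2) : ℝ) * (1 / 2) ≤ Nat.log 2 (R ^ 2) * Real.log 2 := by
      gcongr
      linarith
    linarith
  · have := Real.log_le_log (by positivity) hR2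
    linarith
  · rw [div_mul_eq_mul_div, div_le_iff₀ (by positivity)] at hE4
    have h1 : g ^ 4 * T ^ 7 = (N : ℝ) ^ (4 * ρ + 7 * ε) := by
      rw [hg, hT, hpow, hpow, ← Real.rpow_add hN0]
      norm_num
    rw [← hQ, h1, le_div_iff₀ (by norm_num)]
    refine le_trans ?_ hXlow
    calc _ = 4 * Q * (N : ℝ) ^ (4 * ρ + 7 * ε) * (√(#B : ℝ) * N) := by ring
      _ ≤ (N : ℝ) ^ τ * (κ * c * √c) * (√(#B : ℝ) * N) := by gcongr
      _ = _ := by ring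
  · rw [hT, hpow]
    push_cast
    linarith
  have hD : ∀ P ∈ Icc 1 (3 * N), (#P.divisors : ℝ) ≤ 3 * C₂ * T := by
    intro P hP
    rw [mem_Icc] at hP
    have hP3 : (P : ℝ) ≤ 3 * N := by exact_mod_cast hP.2
    calc _ ≤ C₂ * (P : ℝ) ^ ε := hdiv P hP.1
      _ ≤ C₂ * (3 * N : ℝ) ^ ε := by gcongr
      _ = C₂ * ((3 : ℝ) ^ ε * T) := by rw [Real.mul_rpow (by norm_num) hN0.le]
      _ ≤ C₂ * ((3 : ℝ) ^ (1 : ℝ) * T) := by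
        gcongr
        · norm_num
        · linarith
      _ = _ := by
        rw [Real.rpow_one]
        ring
  obtain ⟨P, hP, hwP, hlen⟩ := exists_pow_length_le (R := R) (M := 3 * N) (w := w) (X := X)
    (E := C * (√(#B : ℝ) * N * T ^ 3)) (L := C₁ * T) (D := 3 * C₂ * T) hR1
    (fun P => sum_nonneg fun a _ => sum_nonneg fun b _ => hk0 _) hX0.le (by positivity)
        (by positivity)
    (fun e he => (hweight R (by omega) e he).trans
      (mul_le_mul_of_nonneg_left (Real.rpow_le_rpow (by positivity) hRN hε0.le) hC₁.le))
    hD hS hform hlarge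
  rw [mem_Icc] at hP
  have hP3 : (P : ℝ) ≤ 3 * N := by exact_mod_cast hP.2
  obtain ⟨a, ha, hwa⟩ := exists_ne_zero_of_sum_ne_zero hwP
  obtain ⟨b, hb, hwb⟩ := exists_ne_zero_of_sum_ne_zero hwa
  refine ⟨a, ha, b, hb, P, hP.1, ?_, ?_⟩
  · by_contra! hlt
    have h1 : (R ^ 2) ^ (⌊3 / τ⌋₊ - 1) ≤ P :=
        le_trans (Nat.pow_le_pow_right (by positivity) (by omega)) hlen
    have h2 : ((R : ℝ) ^ 2) ^ (⌊3 / τ⌋₊ - 1) ≤ P := by exact_mod_cast h1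
    have h3 : (N : ℝ) ^ (2 * ρ * (3 / τ - 2)) ≤ ((R : ℝ) ^ 2) ^ (⌊3 / τ⌋₊ - 1) := by
      calc _ ≤ (N : ℝ) ^ (((2 * (⌊3 / τ⌋₊ - 1) : ℕ) : ℝ) * ρ) := by
            apply Real.rpow_le_rpow_of_exponent_le hN1
            have h4 := Nat.lt_floor_add_one (3 / τ)
            have h5 : (⌊3 / τ⌋₊ : ℝ) ≤ ((⌊3 / τ⌋₊ - 1 : ℕ) : ℝ) + 1 := by
              exact_mod_cast (show ⌊3 / τ⌋₊ ≤ (⌊3 / τ⌋₊ - 1) + 1 by omega)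
            rw [Nat.cast_mul, Nat.cast_ofNat]
            calc 2 * ρ * (3 / τ - 2) ≤ 2 * ρ * (⌊3 / τ⌋₊ - 1 : ℕ) := by
                  gcongr
                  linarith
              _ = _ := by ring
        _ = g ^ (2 * (⌊3 / τ⌋₊ - 1)) := (hpow _ _).symm
        _ ≤ (R : ℝ) ^ (2 * (⌊3 / τ⌋₊ - 1)) := by gcongr
        _ = _ := pow_mul _ _ _
    rw [Real.rpow_one] at hE6
    linarith
  · refine abs_mul_sub_sq_le_of_abs_sub_mul_lt_one hN1 hδ.le (by linarith) (mem_Icc.1 (hA ha))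
      (mem_Icc.1 (hB hb)) ?_
    by_contra! h
    refine hwb (hk1 _ ?_)
    rwa [abs_mul, abs_of_pos (show 0 < V by positivity)]

/-- **Corollary 1.3 (general form).** Under the density hypotheses, there exist
`a ∈ 𝔄`, `b ∈ 𝔅` and an almost-prime `P` with at most `k` prime factors such that
`ab = P² + O(P^{1-δ})`. -/
theorem near_almost_prime_square :
    ∀ η β δ : ℝ, 0 < η → η ≤ 1 → 0 < β → β ≤ 1 → 0 < δ → δ < 1 / 2 →
      ∃ ε₀ : ℝ, 0 < ε₀ ∧ ∀ ε : ℝ, 0 < ε → ε ≤ ε₀ →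
        4 * (1 + δ) / 3 + ε ≤ η + β →
        ∀ c₁ c₂ : ℝ, 0 < c₁ → c₁ ≤ c₂ →
          ∃ C : ℝ, 0 < C ∧ ∃ N₀ : ℕ, ∀ N : ℕ, N₀ ≤ N →
            ∀ A B : Finset ℕ, A ⊆ Finset.Icc (N + 1) (2 * N) → B ⊆ Finset.Icc (N + 1) (2 * N) →
              c₁ * (N : ℝ) ^ η ≤ A.card → (A.card : ℝ) ≤ c₂ * (N : ℝ) ^ η →
              c₁ * (N : ℝ) ^ β ≤ B.card → (B.card : ℝ) ≤ c₂ * (N : ℝ) ^ β →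
                ∃ a ∈ A, ∃ b ∈ B, ∃ P : ℕ, 0 < P ∧
                  P.primeFactorsList.length ≤ ⌊2 / ((η + β) / 2 - 2 / 3 - 2 * δ / 3)⌋₊ ∧
                  |(a * b : ℝ) - (P : ℝ) ^ 2| ≤ C * (P : ℝ) ^ (1 - δ) := by
  intro η β δ hη hη1 hβ hβ1 hδ _
  refine ⟨1, one_pos, fun ε hε _ hsum c₁ c₂ hc₁ _ => ⟨5, by norm_num, ?_⟩⟩
  have hτ : 0 < 3 / 4 * (η + β) - 1 - δ := by linarith
  have hk : 2 / ((η + β) / 2 - 2 / 3 - 2 * δ / 3) = 3 / (3 / 4 * (η + β) - 1 - δ) := by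
    rw [div_eq_div_iff (by linarith) hτ.ne']
    ring
  rw [hk, ← Filter.eventually_atTop]
  rcases le_total β η with h | h
  · filter_upwards [exists_near_square_of_le hη1 hβ h hδ rfl hτ hc₁] with N hN A B hA hB hcA _ hcB _
    exact hN A B hA hB hcA hcB
  · rw [add_comm η β] at hτ ⊢
    filter_upwards [exists_near_square_of_le hβ1 hη h hδ rfl hτ hc₁] with N hN A B hA hB hcA _ hcB _
    obtain ⟨b, hb, a, ha, P, hP, hlen, habs⟩ := hN B A hB hA hcB hcA
    exact ⟨a, ha, b, hb, P, hP, hlen, by rwa [mul_comm (a : ℝ)]⟩
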